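/- arXiv:1511.06102 — 3 statements merged into one kernel-verified Lean document; each statement's English description precedes it below -/
import Mathlib

section
/- Let k ≥ 6 be an even integer and let f be a cusp form of weight k for SL(2,ℤ) which is an eigenform of the Hecke operator T₂ with eigenvalue λ₂, i.e. 2^{k−1}·f(2z) + (1/2)·(f(z/2) + f((z+1)/2)) = λ₂·f(z) for all z in the upper half-plane. Then the coefficient vector of the restricted even period polynomial of f is a left eigenvector of the matrix C²_{k,2}: for every pair (n₁,n₂) ∈ oo(k), Σ_{(m₁,m₂)∈oo(k)} a_{m₁,m₂}(f)·c²((m₁,m₂),(n₁,n₂)) = ((λ₂ − (1 + 2^{k−1}))/2^{k−2})·a_{n₂,n₁}(f). -/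
open Complex MeasureTheory CongruenceSubgroup

noncomputable section

/-- Evaluation of a function on the upper half-plane at a complex number,
extended by `0` off the upper half-plane. -/
def fval (f : UpperHalfPlane → ℂ) (z : ℂ) : ℂ :=
  if h : 0 < z.im then f ⟨z, h⟩ else 0

/-- The totally odd index set `oo(k)`: pairs of odd integers `≥ 3` summing to `k`. -/
def oo (k : ℕ) : Finset (ℕ × ℕ) :=
  (Finset.range (k + 1) ×ˢ Finset.range (k + 1)).filter
    (fun p => Odd p.1 ∧ Odd p.2 ∧ 3 ≤ p.1 ∧ 3 ≤ p.2 ∧ p.1 + p.2 = k)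

/-- The coefficient `a_{m₁,m₂}(f) = C(k-2, m₁-1) ⬝ i^{m₁} ⬝ ∫_0^∞ f(it) t^{m₁-1} dt`
of `x^{m₂-1} y^{m₁-1}` in the period polynomial of `f` (it only depends on `m₁` and `k`). -/
def periodCoeff (k : ℕ) (f : UpperHalfPlane → ℂ) (m₁ : ℕ) : ℂ :=
  (Nat.choose (k - 2) (m₁ - 1) : ℂ) * I ^ m₁ *
    ∫ t in Set.Ioi (0 : ℝ), fval f (I * t) * (t : ℂ) ^ (m₁ - 1)

/-- Integer binomial coefficient with the convention `C(a,b) = 0` unless `0 ≤ b ≤ a`. -/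
def ichoose (a b : ℤ) : ℤ :=
  if 0 ≤ b ∧ b ≤ a then (a.toNat).choose b.toNat else 0

/-- `e((m₁,m₂),(n₁,n₂)) = (-1)^{n₁} C(m₁-1, m₁-n₁) + (-1)^{m₁-n₂} C(m₁-1, m₁-n₂)`. -/
def eEntry (m n : ℕ × ℕ) : ℚ :=
  (-1 : ℚ) ^ (n.1 : ℤ) * (ichoose ((m.1 : ℤ) - 1) ((m.1 : ℤ) - (n.1 : ℤ)) : ℚ) +
  (-1 : ℚ) ^ ((m.1 : ℤ) - (n.2 : ℤ)) * (ichoose ((m.1 : ℤ) - 1) ((m.1 : ℤ) - (n.2 : ℤ)) : ℚ)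

/-- Kronecker delta on index pairs. -/
def deltaEntry (m n : ℕ × ℕ) : ℚ := if m = n then 1 else 0

/-- The entry `c²((m₁,m₂),(n₁,n₂))` of the matrix `C²_{k,2}`. -/
def c2Entry (m n : ℕ × ℕ) : ℚ :=
  ((2 : ℚ) ^ (1 - (m.1 : ℤ)) - 1) *
    (((2 : ℚ) ^ (1 - (m.2 : ℤ)) - 1) * deltaEntry m n + eEntry m n)

/-- The analytic properties of a level-one cusp form of weight `w + 2`, extended to `ℂ`. -/
structure IsCuspFunction (w : ℕ) (φ : ℂ → ℂ) : Prop where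
  differentiableOn : DifferentiableOn ℂ φ {z | 0 < z.im}
  add_one : ∀ z : ℂ, 0 < z.im → φ (z + 1) = φ z
  neg_inv : ∀ z : ℂ, 0 < z.im → φ (-1 / z) = z ^ (w + 2) * φ z
  decay : ∀ n : ℕ, ∃ C Y : ℝ, ∀ z : ℂ, 0 < z.im → Y ≤ z.im → ‖φ z‖ ≤ C / z.im ^ n

theorem isCuspFunction_fval (w : ℕ)
    (f : CuspForm (⊤ : Subgroup (Matrix.SpecialLinearGroup (Fin 2) ℤ)) ((w + 2 : ℕ) : ℤ)) :
    IsCuspFunction w (fval f) where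
  differentiableOn := by
    have h := UpperHalfPlane.mdifferentiable_iff.mp (CuspFormClass.holo f)
    refine h.congr fun z hz => ?_
    have hz' : 0 < z.im := hz
    simp [fval, hz', UpperHalfPlane.ofComplex_apply_of_im_pos hz']
  add_one z hz := by
    have h := SlashInvariantForm.slash_action_eqn_SL'' f (γ := ModularGroup.T)
      (Subgroup.mem_top _) ⟨z, hz⟩
    rw [UpperHalfPlane.modular_T_smul] at h
    have e : (1 : ℝ) +ᵥ (⟨z, hz⟩ : UpperHalfPlane) = ⟨z + 1, by simpa using hz⟩ := by
      ext1
      simp [add_comm]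
    rw [e, ModularGroup.denom_apply] at h
    simpa [fval, hz, ModularGroup.T] using h
  neg_inv z hz := by
    have h := SlashInvariantForm.slash_action_eqn_SL'' f (γ := ModularGroup.S)
      (Subgroup.mem_top _) ⟨z, hz⟩
    have hi : 0 < (-1 / z).im := by
      have := (UpperHalfPlane.mk z hz).im_inv_neg_coe_pos
      rw [inv_neg] at this
      rwa [neg_div, one_div]
    have e : ModularGroup.S • (⟨z, hz⟩ : UpperHalfPlane) = ⟨-1 / z, hi⟩ := by
      rw [UpperHalfPlane.modular_S_smul]
      ext1
      simp [inv_neg, neg_div]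
    rw [e, ModularGroup.denom_S] at h
    rw [zpow_natCast] at h
    simpa [fval, hz, hi] using h
  decay n := by
    obtain ⟨c, hc, h⟩ := CuspFormClass.exp_decay_atImInfty' f
    obtain ⟨C, hC, h⟩ := h.exists_pos
    rw [Asymptotics.IsBigOWith, UpperHalfPlane.atImInfty, Filter.eventually_comap,
      Filter.eventually_atTop] at h
    obtain ⟨Y, hY⟩ := h
    have ht := Real.tendsto_pow_mul_exp_neg_atTop_nhds_zero n
    have ht' := ht.comp (Filter.tendsto_id.const_mul_atTop hc)
    obtain ⟨Y', hY'⟩ := Filter.eventually_atTop.mp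
      (ht'.eventually (gt_mem_nhds (show (0 : ℝ) < 1 by norm_num)))
    refine ⟨C / c ^ n, max Y Y', fun z hz hzY => ?_⟩
    have h1 := hY _ ((le_max_left _ _).trans hzY) ⟨z, hz⟩ rfl
    have h2 := hY' _ ((le_max_right _ _).trans hzY)
    simp only [Function.comp, id] at h2
    simp only [fval, hz, dif_pos]
    refine h1.trans ?_
    rw [Real.norm_of_nonneg (Real.exp_pos _).le, div_div, le_div_iff₀ (by positivity), mul_assoc]
    refine mul_le_of_le_one_right hC.le ?_
    rw [← mul_pow, mul_comm, neg_mul]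
    exact h2.le

/-- `F` is a primitive of `φ(z) (a z + b) ^ w` on the upper half-plane. -/
def IsPeriodPrimitive (w : ℕ) (φ : ℂ → ℂ) (a b : ℂ) (F : ℂ → ℂ) : Prop :=
  ∀ z : ℂ, 0 < z.im → HasDerivAt F (φ z * (a * z + b) ^ w) z

/-- The integral of `φ(z) (a z + b) ^ w dz` along the imaginary axis. -/
def periodIntegral (w : ℕ) (φ : ℂ → ℂ) (a b : ℂ) : ℂ :=
  ∫ t in Set.Ioi (0 : ℝ), φ (I * t) * (a * (I * t) + b) ^ w * I

namespace IsCuspFunction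

open Filter Topology

variable {w : ℕ} {φ : ℂ → ℂ}

theorem exists_primitive (hφ : IsCuspFunction w φ) (a b : ℂ) :
    ∃ F, IsPeriodPrimitive w φ a b F := by
  have hd : DifferentiableOn ℂ (fun z => φ z * (a * z + b) ^ w) {z | 0 < z.im} :=
    hφ.differentiableOn.mul (by fun_prop)
  obtain ⟨F, hF⟩ := (convex_halfSpace_im_gt 0).exists_forall_hasDerivWithinAt hd
  exact ⟨F, fun z hz => (hF z hz).hasDerivAt
    ((isOpen_lt continuous_const Complex.continuous_im).mem_nhds hz)⟩

theorem add_natCast (hφ : IsCuspFunction w φ) (n : ℕ) {z : ℂ} (hz : 0 < z.im) :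
    φ (z + n) = φ z := by
  induction n with
  | zero => simp
  | succ n ih => rw [Nat.cast_succ, ← add_assoc, hφ.add_one _ (by simpa using hz), ih]

theorem im_neg_inv_pos {z : ℂ} (hz : 0 < z.im) : 0 < (-1 / z).im := by
  have hn : 0 < normSq z := normSq_pos.mpr fun h => by simp [h] at hz
  rw [neg_div, one_div, neg_im, inv_im, neg_div, neg_neg]
  exact div_pos hz hn

theorem ne_zero_of_im_pos {z : ℂ} (hz : 0 < z.im) : z ≠ 0 := fun h => by simp [h] at hz

theorem natCast_mul_add_one_ne_zero (n : ℕ) {z : ℂ} (hz : 0 < z.im) : (n : ℂ) * z + 1 ≠ 0 := by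
  intro h
  have h1 := congrArg Complex.im h
  have h2 := congrArg Complex.re h
  simp at h1 h2
  rcases h1 with rfl | h1
  · simp at h2
  · exact hz.ne' h1

theorem div_natCast_mul_add_one (n : ℕ) {z : ℂ} (hz : 0 < z.im) :
    z / (n * z + 1) = -1 / (-1 / z - n) := by
  have h0 := ne_zero_of_im_pos hz
  have h1 := natCast_mul_add_one_ne_zero n hz
  have h2 : -1 / z - n = -(n * z + 1) / z := by field_simp; ring
  rw [h2]
  field_simp

theorem im_div_natCast_mul_add_one_pos (n : ℕ) {z : ℂ} (hz : 0 < z.im) :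
    0 < (z / (n * z + 1)).im := by
  rw [div_natCast_mul_add_one n hz]
  exact im_neg_inv_pos (by simpa using im_neg_inv_pos hz)

theorem apply_div_natCast_mul_add_one (hφ : IsCuspFunction w φ) (hw : Even w) (n : ℕ) {z : ℂ}
    (hz : 0 < z.im) : φ (z / (n * z + 1)) = (n * z + 1) ^ (w + 2) * φ z := by
  have h0 := ne_zero_of_im_pos hz
  have hi : 0 < (-1 / z - n).im := by simpa using im_neg_inv_pos hz
  have h2 : -1 / z - n = -((n * z + 1) / z) := by field_simp; ring
  rw [div_natCast_mul_add_one n hz, hφ.neg_inv _ hi, ← hφ.add_natCast n hi, sub_add_cancel,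
    hφ.neg_inv z hz, h2, (hw.add even_two).neg_pow, div_pow]
  field_simp

end IsCuspFunction

namespace IsPeriodPrimitive

open Filter Topology

variable {w : ℕ} {φ : ℂ → ℂ} {a b : ℂ} {F : ℂ → ℂ}

theorem comp_moebius (hF : IsPeriodPrimitive w φ a b F) (p q r s : ℂ) (hdet : p * s - q * r = 1)
    (hne : ∀ z : ℂ, 0 < z.im → r * z + s ≠ 0)
    (him : ∀ z : ℂ, 0 < z.im → 0 < ((p * z + q) / (r * z + s)).im)
    (hφ : ∀ z : ℂ, 0 < z.im → φ ((p * z + q) / (r * z + s)) = (r * z + s) ^ (w + 2) * φ z) :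
    IsPeriodPrimitive w φ (a * p + b * r) (a * q + b * s)
      (fun z => F ((p * z + q) / (r * z + s))) := by
  intro z hz
  have hn := hne z hz
  have h1 : HasDerivAt (fun z : ℂ => (p * z + q) / (r * z + s))
      ((p * (r * z + s) - (p * z + q) * r) / (r * z + s) ^ 2) z := by
    have hp : HasDerivAt (fun z : ℂ => p * z + q) p z := by
      simpa using ((hasDerivAt_id z).const_mul p).add_const q
    have hr : HasDerivAt (fun z : ℂ => r * z + s) r z := by
      simpa using ((hasDerivAt_id z).const_mul r).add_const s
    exact hp.div hr hn
  refine ((hF _ (him z hz)).comp z h1).congr_deriv ?_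
  have h2 : p * (r * z + s) - (p * z + q) * r = 1 := by linear_combination hdet
  have h3 : a * ((p * z + q) / (r * z + s)) + b
      = ((a * p + b * r) * z + (a * q + b * s)) / (r * z + s) := by
    rw [mul_div_assoc', div_add' _ _ _ hn]
    ring
  rw [hφ z hz, h2, h3, div_pow]
  field_simp
  ring

theorem comp_neg_inv (hF : IsPeriodPrimitive w φ a b F) (hφ : IsCuspFunction w φ) :
    IsPeriodPrimitive w φ b (-a) (fun z => F (-1 / z)) := by
  have := hF.comp_moebius 0 (-1) 1 0 (by ring)
    (fun z hz => by simpa using IsCuspFunction.ne_zero_of_im_pos hz)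
    (fun z hz => by simpa using IsCuspFunction.im_neg_inv_pos hz)
    (fun z hz => by simpa using hφ.neg_inv z hz)
  simpa using this

theorem comp_add_one (hF : IsPeriodPrimitive w φ a b F) (hφ : IsCuspFunction w φ) :
    IsPeriodPrimitive w φ a (a + b) (fun z => F (z + 1)) := by
  have := hF.comp_moebius 1 1 0 1 (by ring) (by simp) (fun z hz => by simpa using hz)
    (fun z hz => by simpa using hφ.add_one z hz)
  simpa using this

theorem comp_div_natCast_mul_add_one (hF : IsPeriodPrimitive w φ a b F)
    (hφ : IsCuspFunction w φ) (hw : Even w) (n : ℕ) :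
    IsPeriodPrimitive w φ (a + n * b) b (fun z => F (z / (n * z + 1))) := by
  have := hF.comp_moebius 1 0 n 1 (by ring)
    (fun z hz => IsCuspFunction.natCast_mul_add_one_ne_zero n hz)
    (fun z hz => by simpa using IsCuspFunction.im_div_natCast_mul_add_one_pos n hz)
    (fun z hz => by simpa using hφ.apply_div_natCast_mul_add_one hw n hz)
  simpa [mul_comm b] using this

theorem tendsto_horizontal (hF : IsPeriodPrimitive w φ a b F) (hφ : IsCuspFunction w φ) (s : ℝ) :
    Tendsto (fun T : ℝ => F (I * T + s) - F (I * T)) atTop (𝓝 0) := by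
  obtain ⟨C, Y, hC⟩ := hφ.decay (w + 1)
  set K : ℝ := C * (‖a‖ * (1 + |s|) + ‖b‖) ^ w * |s| with hK
  refine squeeze_zero_norm' (a := fun T : ℝ => K / T) ?_ (tendsto_const_nhds.div_atTop tendsto_id)
  filter_upwards [eventually_ge_atTop Y, eventually_ge_atTop 1] with T hT hT1
  have hT0 : 0 < T := by linarith
  have hseg : ∀ z ∈ segment ℝ (I * T) (I * T + s), z.im = T ∧ ‖z‖ ≤ T * (1 + |s|) := by
    rintro z hz
    rw [segment_eq_image'] at hz
    obtain ⟨θ, ⟨h0, h1⟩, rfl⟩ := hz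
    refine ⟨by simp, ?_⟩
    simp only [add_sub_cancel_left]
    refine (norm_add_le _ _).trans ?_
    have hθ : θ * |s| ≤ |s| := mul_le_of_le_one_left (abs_nonneg s) h1
    have hs : |s| ≤ T * |s| := le_mul_of_one_le_left (abs_nonneg s) hT1
    simp [abs_of_pos hT0, abs_of_nonneg h0]
    linarith
  have hmv := (convex_segment (𝕜 := ℝ) (I * T : ℂ) (I * T + s)).norm_image_sub_le_of_norm_hasDerivWithin_le
    (f := F) (f' := fun z => φ z * (a * z + b) ^ w)
    (C := C / T ^ (w + 1) * (T * (‖a‖ * (1 + |s|) + ‖b‖)) ^ w)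
    (fun z hz => (hF z ((hseg z hz).1 ▸ hT0)).hasDerivWithinAt)
    (fun z hz => by
      obtain ⟨h1, h2⟩ := hseg z hz
      rw [norm_mul, norm_pow]
      have h3 := hC z (h1 ▸ hT0) (h1 ▸ hT)
      rw [h1] at h3
      have h5 : ‖a * z + b‖ ≤ T * (‖a‖ * (1 + |s|) + ‖b‖) := by
        refine (norm_add_le _ _).trans ?_
        rw [norm_mul]
        have := mul_le_mul_of_nonneg_left h2 (norm_nonneg a)
        have := le_mul_of_one_le_left (norm_nonneg b) hT1
        linarith
      exact mul_le_mul h3 (pow_le_pow_left₀ (norm_nonneg _) h5 w) (by positivity)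
        ((norm_nonneg _).trans h3))
    (left_mem_segment ℝ _ _) (right_mem_segment ℝ _ _)
  refine hmv.trans (le_of_eq ?_)
  rw [add_sub_cancel_left, norm_real, Real.norm_eq_abs, hK, mul_pow]
  field_simp
  ring

end IsPeriodPrimitive

open Filter Topology in
/-- An improper form of the fundamental theorem of calculus on `(0, ∞)`. -/
theorem tendsto_sub_of_hasDerivAt_Ioi {g ψ : ℝ → ℂ} (hg : ∀ t, 0 < t → HasDerivAt g (ψ t) t)
    (hψ : IntegrableOn ψ (Set.Ioi 0)) {c : ℝ} (hc : 0 < c) :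
    Tendsto (fun T : ℝ => g T - g (1 / (c * T))) atTop (𝓝 (∫ t in Set.Ioi (0 : ℝ), ψ t)) := by
  have hl : Tendsto (fun T : ℝ => 1 / (c * T)) atTop (𝓝 0) :=
    tendsto_const_nhds.div_atTop (tendsto_id.const_mul_atTop hc)
  have hcov : AECover (volume.restrict (Set.Ioi (0 : ℝ))) atTop
      (fun T : ℝ => Set.Ioc (1 / (c * T)) T) := {
    ae_eventually_mem := by
      filter_upwards [ae_restrict_mem measurableSet_Ioi] with t ht
      filter_upwards [hl.eventually_lt_const (Set.mem_Ioi.mp ht), eventually_ge_atTop t]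
        with T h1 h2
      exact ⟨h1, h2⟩
    measurableSet := fun _ => measurableSet_Ioc }
  refine (hcov.integral_tendsto_of_countably_generated hψ).congr' ?_
  filter_upwards [hl.eventually_lt_const one_pos, eventually_ge_atTop 1] with T h1 h2
  have hpos : 0 < 1 / (c * T) := by positivity
  have hle : 1 / (c * T) ≤ T := h1.le.trans h2
  have hsub : Set.Ioc (1 / (c * T)) T ⊆ Set.Ioi 0 := fun t ht => hpos.trans ht.1
  rw [Measure.restrict_restrict measurableSet_Ioc, Set.inter_eq_left.mpr hsub,
    ← intervalIntegral.integral_of_le hle]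
  refine intervalIntegral.integral_eq_sub_of_hasDerivAt (fun t ht => hg t ?_)
    ((intervalIntegrable_iff_integrableOn_Ioc_of_le hle).mpr (hψ.mono_set hsub))
  rw [Set.uIcc_of_le hle] at ht
  exact hpos.trans_le ht.1

namespace IsCuspFunction

open Filter Topology

variable {w : ℕ} {φ : ℂ → ℂ}

theorem integrableOn_mul_pow (hφ : IsCuspFunction w φ) (j : ℕ) :
    IntegrableOn (fun t : ℝ => φ (I * t) * (t : ℂ) ^ j) (Set.Ioi 0) := by
  have hcont : ContinuousOn (fun t : ℝ => φ (I * t)) (Set.Ioi 0) :=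
    hφ.differentiableOn.continuousOn.comp (by fun_prop) fun t ht => by simpa using ht
  have htop : (fun t : ℝ => φ (I * t)) =O[atTop] fun t : ℝ => t ^ (-((j : ℝ) + 2)) := by
    obtain ⟨C, Y, hC⟩ := hφ.decay (j + 2)
    refine Asymptotics.IsBigO.of_bound C ?_
    filter_upwards [eventually_ge_atTop Y, eventually_gt_atTop 0] with t ht ht0
    have h := hC (I * t) (by simpa using ht0) (by simpa using ht)
    rw [Real.norm_of_nonneg (Real.rpow_nonneg ht0.le _), Real.rpow_neg ht0.le, ← div_eq_mul_inv]
    rw [show (j : ℝ) + 2 = ((j + 2 : ℕ) : ℝ) by simp, Real.rpow_natCast]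
    simpa using h
  have hbot : (fun t : ℝ => φ (I * t)) =O[𝓝[>] 0] fun t : ℝ => t ^ (-(0 : ℝ)) := by
    obtain ⟨C, Y, hC⟩ := hφ.decay (w + 2)
    refine Asymptotics.IsBigO.of_bound C ?_
    filter_upwards [self_mem_nhdsWithin, (tendsto_inv_nhdsGT_zero (𝕜 := ℝ)).eventually_ge_atTop Y]
      with t (ht : 0 < t) htY
    have e : (I * t : ℂ) = -1 / (I * (t⁻¹ : ℝ)) := by
      have : (t : ℂ) ≠ 0 := by exact_mod_cast ht.ne'
      push_cast
      field_simp
      simp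
    have h := hC (I * (t⁻¹ : ℝ)) (by simpa using ht) (by simpa using htY)
    rw [e, hφ.neg_inv _ (by simpa using ht), norm_mul, norm_pow]
    have ht' : 0 < (t⁻¹) ^ (w + 2) := by positivity
    have hn : ‖I * ((t⁻¹ : ℝ) : ℂ)‖ = t⁻¹ := by simp [abs_of_pos ht]
    rw [hn]
    simp only [neg_zero, Real.rpow_zero, norm_one, mul_one]
    have h' : ‖φ (I * (t⁻¹ : ℝ))‖ ≤ C / (t⁻¹) ^ (w + 2) := by simpa using h
    rwa [le_div_iff₀ ht', mul_comm] at h'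
  have hm := mellinConvergent_of_isBigO_rpow (s := (j + 1 : ℂ))
    (hcont.locallyIntegrableOn measurableSet_Ioi) htop (by simp) hbot
    (by simp; positivity)
  refine hm.congr_fun (fun t _ => ?_) measurableSet_Ioi
  simp [mul_comm]

theorem integrableOn_mul_linear_pow (hφ : IsCuspFunction w φ) (a b : ℂ) (n : ℕ) :
    IntegrableOn (fun t : ℝ => φ (I * t) * (a * (I * t) + b) ^ n * I) (Set.Ioi 0) := by
  have : (fun t : ℝ => φ (I * t) * (a * (I * t) + b) ^ n * I) = fun t : ℝ =>
      ∑ j ∈ Finset.range (n + 1),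
        (a * I) ^ j * b ^ (n - j) * n.choose j * I * (φ (I * t) * (t : ℂ) ^ j) := by
    ext t
    rw [add_pow, Finset.mul_sum, Finset.sum_mul]
    refine Finset.sum_congr rfl fun j _ => ?_
    ring
  rw [this]
  exact integrable_finsetSum _ fun j _ => (hφ.integrableOn_mul_pow j).const_mul _

/-- The binomial expansion of the period integral. -/
theorem periodIntegral_eq_sum (hφ : IsCuspFunction w φ) (a b : ℂ) :
    periodIntegral w φ a b = ∑ j ∈ Finset.range (w + 1),
      w.choose j * I ^ (j + 1) * (∫ t in Set.Ioi (0 : ℝ), φ (I * t) * (t : ℂ) ^ j) *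
        (a ^ j * b ^ (w - j)) := by
  have : (fun t : ℝ => φ (I * t) * (a * (I * t) + b) ^ w * I) = fun t : ℝ =>
      ∑ j ∈ Finset.range (w + 1),
        (a * I) ^ j * b ^ (w - j) * w.choose j * I * (φ (I * t) * (t : ℂ) ^ j) := by
    ext t
    rw [add_pow, Finset.mul_sum, Finset.sum_mul]
    refine Finset.sum_congr rfl fun j _ => ?_
    ring
  rw [periodIntegral, this, integral_finsetSum _ fun j _ =>
    (hφ.integrableOn_mul_pow j).const_mul _]
  refine Finset.sum_congr rfl fun j _ => ?_
  rw [integral_const_mul]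
  ring

theorem integral_comp_mul_left (a b : ℂ) {c : ℝ} (hc : 0 < c) :
    ∫ t in Set.Ioi (0 : ℝ), φ (I * (c * t : ℝ)) * (a * (I * (c * t : ℝ)) + b) ^ w * I
      = (c : ℂ)⁻¹ * periodIntegral w φ a b := by
  rw [integral_comp_mul_left_Ioi (fun t : ℝ => φ (I * t) * (a * (I * t) + b) ^ w * I) 0 hc]
  simp [periodIntegral]

theorem integrableOn_comp_mul_left (hφ : IsCuspFunction w φ) (a b : ℂ) {c : ℝ} (hc : 0 < c) :
    IntegrableOn (fun t : ℝ => φ (I * (c * t : ℝ)) * (a * (I * (c * t : ℝ)) + b) ^ w * I)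
      (Set.Ioi 0) := by
  rw [integrableOn_Ioi_comp_mul_left_iff
    (fun t : ℝ => φ (I * t) * (a * (I * t) + b) ^ w * I) 0 hc, mul_zero]
  exact hφ.integrableOn_mul_linear_pow a b w

theorem tendsto_primitive (hφ : IsCuspFunction w φ) {a b : ℂ} {F : ℂ → ℂ}
    (hF : IsPeriodPrimitive w φ a b F) :
    Tendsto (fun T : ℝ => F (I * T) - F (I * (1 / T : ℝ))) atTop
      (𝓝 (periodIntegral w φ a b)) := by
  have h := tendsto_sub_of_hasDerivAt_Ioi (g := fun t : ℝ => F (I * t)) (fun t ht => ?_)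
    (hφ.integrableOn_mul_linear_pow a b w) one_pos
  · simpa [periodIntegral] using h
  · have h1 : HasDerivAt (fun t : ℝ => I * (t : ℂ)) I t := by
      simpa using (hasDerivAt_id t).ofReal_comp.const_mul I
    exact (hF (I * t) (by simpa using ht)).comp t h1

theorem periodIntegral_neg_inv (hφ : IsCuspFunction w φ) (a b : ℂ) :
    periodIntegral w φ b (-a) = -periodIntegral w φ a b := by
  obtain ⟨F, hF⟩ := hφ.exists_primitive a b
  refine tendsto_nhds_unique (hφ.tendsto_primitive (hF.comp_neg_inv hφ)) ?_
  refine (hφ.tendsto_primitive hF).neg.congr' ?_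
  filter_upwards [eventually_gt_atTop 0] with T hT
  have hT' : (T : ℂ) ≠ 0 := by exact_mod_cast hT.ne'
  have e1 : -1 / (I * T) = I * (1 / T : ℝ) := by
    push_cast
    field_simp
    simp
  have e2 : -1 / (I * (1 / T : ℝ)) = I * T := by
    push_cast
    field_simp
    simp
  simp only [e1, e2]
  ring

/-- The integral from the cusp `1 / n` to `∞`, in terms of a primitive along the vertical line. -/
theorem tendsto_primitive_inv_natCast (hφ : IsCuspFunction w φ) (hw : Even w) {a b : ℂ}
    {F : ℂ → ℂ} (hF : IsPeriodPrimitive w φ a b F) {n : ℕ} (hn : 0 < n) :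
    Tendsto (fun T : ℝ => F (I * T + (1 / n : ℝ)) - F (I * (1 / (n ^ 2 * T) : ℝ) + (1 / n : ℝ)))
      atTop (𝓝 (periodIntegral w φ a b - periodIntegral w φ (a + n * b) b)) := by
  have hG := hF.comp_div_natCast_mul_add_one hφ hw n
  have h1 := hF.tendsto_horizontal hφ (1 / n)
  have h2 := (hF.comp_neg_inv hφ).tendsto_horizontal hφ (-n)
  have h3 := hG.tendsto_horizontal hφ (-(1 / n))
  have h := (((hφ.tendsto_primitive hF).sub (hφ.tendsto_primitive hG)).add h1).sub
    (h2.add h3)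
  simp only [add_zero, sub_zero] at h
  refine h.congr' ?_
  filter_upwards [eventually_gt_atTop 0] with T hT
  have hT' : (T : ℂ) ≠ 0 := by exact_mod_cast hT.ne'
  have hn' : (n : ℂ) ≠ 0 := by exact_mod_cast hn.ne'
  have e1 : -1 / (I * T) = I * (1 / T : ℝ) := by
    push_cast
    field_simp
    simp
  have e2 : -1 / (I * T + (-(n : ℝ) : ℝ)) = I * (1 / T : ℝ) / (n * (I * (1 / T : ℝ)) + 1) := by
    rw [div_natCast_mul_add_one n (by simpa using hT), ← e1]
    congr 1
    field_simp
    push_cast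
    ring
  have e3 : (I * T + (-(1 / n : ℝ) : ℝ)) / (n * (I * T + (-(1 / n : ℝ) : ℝ)) + 1)
      = I * (1 / (n ^ 2 * T) : ℝ) + (1 / n : ℝ) := by
    have : (n : ℂ) * (I * T + (-(1 / n : ℝ) : ℝ)) + 1 = n * (I * T) := by
      push_cast
      field_simp
      ring
    rw [this]
    push_cast
    field_simp
    linear_combination -I_sq
  simp only [e1, e2, e3]
  ring

theorem periodIntegral_three_term (hφ : IsCuspFunction w φ) (hw : Even w) (a b : ℂ) :
    periodIntegral w φ a b = periodIntegral w φ a (a + b) + periodIntegral w φ (a + b) b := by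
  obtain ⟨F, hF⟩ := hφ.exists_primitive a b
  have h := hφ.tendsto_primitive_inv_natCast hw hF one_pos
  have h' := hφ.tendsto_primitive (hF.comp_add_one hφ)
  have := tendsto_nhds_unique h (by simpa using h')
  rw [Nat.cast_one, one_mul] at this
  linear_combination this

theorem periodIntegral_hecke (hφ : IsCuspFunction w φ) (hw : Even w) {lam : ℂ}
    (heig : ∀ z : ℂ, 0 < z.im →
      2 ^ (w + 1) * φ (2 * z) + (1 / 2) * (φ (z / 2) + φ ((z + 1) / 2)) = lam * φ z) (x y : ℂ) :
    lam * periodIntegral w φ y x = periodIntegral w φ y (2 * x) + periodIntegral w φ (2 * y) x +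
      periodIntegral w φ (2 * y) (x - y) - periodIntegral w φ (2 * x) (x - y) := by
  obtain ⟨F, hF⟩ := hφ.exists_primitive (2 * y) (x - y)
  have h := hφ.tendsto_primitive_inv_natCast hw hF two_pos
  set ψ : ℝ → ℂ := fun t =>
    2 * lam * (φ (I * (2 * t : ℝ)) * (y * (I * (2 * t : ℝ)) + x) ^ w * I)
    - 2 ^ (w + 2) * (φ (I * (4 * t : ℝ)) * (y / 2 * (I * (4 * t : ℝ)) + x) ^ w * I)
    - φ (I * t) * (2 * y * (I * t) + x) ^ w * I with hψ
  have i1 := (hφ.integrableOn_comp_mul_left y x two_pos).const_mul (2 * lam)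
  have i2 := (hφ.integrableOn_comp_mul_left (y / 2) x four_pos).const_mul (2 ^ (w + 2))
  have i3 := hφ.integrableOn_mul_linear_pow (2 * y) x w
  have hint : IntegrableOn ψ (Set.Ioi 0) := (i1.sub i2).sub i3
  have hval : ∫ t in Set.Ioi (0 : ℝ), ψ t = lam * periodIntegral w φ y x
      - 2 ^ w * periodIntegral w φ (y / 2) x - periodIntegral w φ (2 * y) x := by
    refine (integral_sub (i1.sub i2) i3).trans ?_
    rw [integral_sub' i1 i2, integral_const_mul,
      integral_const_mul, integral_comp_mul_left y x two_pos,
      integral_comp_mul_left (y / 2) x four_pos, periodIntegral, periodIntegral, periodIntegral]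
    push_cast
    ring
  have h' := tendsto_sub_of_hasDerivAt_Ioi (g := fun t : ℝ => F (I * t + (1 / 2 : ℝ)))
    (fun t ht => ?_) hint four_pos
  · have e := tendsto_nhds_unique h (by norm_num at h' ⊢; exact h')
    have hscale : 2 ^ w * periodIntegral w φ (y / 2) x = periodIntegral w φ y (2 * x) := by
      rw [periodIntegral, periodIntegral, ← integral_const_mul]
      congr 1 with t
      have : y * (I * t) + 2 * x = 2 * (y / 2 * (I * t) + x) := by ring
      rw [this, mul_pow]
      ring
    rw [hval, hscale] at e
    have e' : 2 * y + ((2 : ℕ) : ℂ) * (x - y) = 2 * x := by push_cast; ring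
    rw [e'] at e
    linear_combination -e
  · have h1 : HasDerivAt (fun t : ℝ => I * (t : ℂ) + ((1 / 2 : ℝ) : ℂ)) I t := by
      simpa using ((hasDerivAt_id t).ofReal_comp.const_mul I).add_const ((1 / 2 : ℝ) : ℂ)
    refine ((hF (I * t + (1 / 2 : ℝ)) (by simpa using ht)).comp t h1).congr_deriv ?_
    have he := heig (I * (2 * t : ℝ)) (by simpa using ht)
    rw [show (2 : ℂ) * (I * (2 * t : ℝ)) = I * (4 * t : ℝ) by push_cast; ring,
      show (I * (2 * t : ℝ) : ℂ) / 2 = I * t by push_cast; ring,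
      show (I * (2 * t : ℝ) + 1 : ℂ) / 2 = I * t + (1 / 2 : ℝ) by push_cast; ring] at he
    have e1 : 2 * y * (I * t + (1 / 2 : ℝ)) + (x - y) = 2 * y * (I * t) + x := by
      push_cast
      ring
    have e2 : y * (I * (2 * t : ℝ)) + x = 2 * y * (I * t) + x := by
      push_cast
      ring
    have e3 : y / 2 * (I * (4 * t : ℝ)) + x = 2 * y * (I * t) + x := by
      push_cast
      ring
    simp only [hψ, e1, e2, e3]
    linear_combination (2 * (2 * y * (I * t) + x) ^ w * I) * he

end IsCuspFunction

/-- Comparing the coefficients of `y ^ l` in an identity of polynomial functions. -/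
theorem coeff_eq_of_forall_sum_eq {w l : ℕ} (hl : l ≤ w) (B D : ℕ → ℂ)
    (h : ∀ y : ℂ, ∑ j ∈ Finset.range (w + 1), B j * y ^ j =
      ∑ j ∈ Finset.range (w + 1), D j * ((1 + y) ^ j - (1 + y) ^ j * y ^ (w - j))) :
    B l = ∑ j ∈ Finset.range (w + 1), D j * ((j.choose l : ℂ) - j.choose (w - l)) := by
  open Polynomial in
  have hp : ∑ j ∈ Finset.range (w + 1), C (B j) * X ^ j =
      ∑ j ∈ Finset.range (w + 1), C (D j) * ((1 + X) ^ j - (1 + X) ^ j * X ^ (w - j)) := by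
    refine Polynomial.funext fun y => ?_
    simpa [eval_finsetSum] using h y
  have hc := congrArg (fun p => Polynomial.coeff p l) hp
  simp only [Polynomial.finsetSum_coeff] at hc
  rw [Finset.sum_eq_single l (fun j _ hj => by rw [Polynomial.coeff_C_mul_X_pow, if_neg hj.symm])
    (fun hn => absurd (Finset.mem_range.mpr (by omega)) hn), Polynomial.coeff_C_mul_X_pow,
    if_pos rfl] at hc
  rw [hc]
  refine Finset.sum_congr rfl fun j hj => ?_
  have hj' : j ≤ w := by simpa [Nat.lt_succ_iff] using hj
  rw [Polynomial.coeff_C_mul, Polynomial.coeff_sub, Polynomial.coeff_one_add_X_pow,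
    Polynomial.coeff_mul_X_pow', Polynomial.coeff_one_add_X_pow]
  congr 2
  split_ifs with hwl
  · rw [← Nat.choose_symm_of_eq_add (show j = (w - l) + (l - (w - j)) by omega)]
  · rw [Nat.choose_eq_zero_of_lt (by omega), Nat.cast_zero]

/-- The part of the period integral which is even in `a`. -/
def evenPeriodIntegral (w : ℕ) (φ : ℂ → ℂ) (a b : ℂ) : ℂ :=
  (periodIntegral w φ a b + periodIntegral w φ (-a) b) / 2

/-- The coefficients of the even part of the period polynomial. -/
def evenPeriodCoeff (w : ℕ) (φ : ℂ → ℂ) (j : ℕ) : ℂ :=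
  if Even j then w.choose j * I ^ (j + 1) * ∫ t in Set.Ioi (0 : ℝ), φ (I * t) * (t : ℂ) ^ j else 0

namespace IsCuspFunction

variable {w : ℕ} {φ : ℂ → ℂ}

theorem evenPeriodIntegral_eq_sub (hφ : IsCuspFunction w φ) (a b : ℂ) :
    evenPeriodIntegral w φ a b = (periodIntegral w φ a b - periodIntegral w φ b a) / 2 := by
  have h := hφ.periodIntegral_neg_inv (-a) b
  rw [neg_neg] at h
  rw [evenPeriodIntegral]
  linear_combination h / 2

theorem evenPeriodIntegral_swap (hφ : IsCuspFunction w φ) (a b : ℂ) :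
    evenPeriodIntegral w φ b a = -evenPeriodIntegral w φ a b := by
  rw [hφ.evenPeriodIntegral_eq_sub, hφ.evenPeriodIntegral_eq_sub]
  ring

theorem evenPeriodIntegral_neg (a b : ℂ) :
    evenPeriodIntegral w φ (-a) b = evenPeriodIntegral w φ a b := by
  rw [evenPeriodIntegral, evenPeriodIntegral, neg_neg, add_comm]

theorem evenPeriodIntegral_three_term (hφ : IsCuspFunction w φ) (hw : Even w) (a b : ℂ) :
    evenPeriodIntegral w φ a b =
      evenPeriodIntegral w φ (a + b) b - evenPeriodIntegral w φ (a + b) a := by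
  have h1 := hφ.periodIntegral_three_term hw a b
  have h2 := hφ.periodIntegral_three_term hw b a
  rw [add_comm b a] at h2
  simp only [hφ.evenPeriodIntegral_eq_sub]
  linear_combination (h1 - h2) / 2

theorem periodIntegral_neg_neg (hw : Even w) (a b : ℂ) :
    periodIntegral w φ (-a) (-b) = periodIntegral w φ a b := by
  rw [periodIntegral, periodIntegral]
  congr 1 with t
  rw [← hw.neg_pow (a * (I * t) + b)]
  ring

theorem evenPeriodIntegral_hecke (hφ : IsCuspFunction w φ) (hw : Even w) {lam : ℂ}
    (heig : ∀ z : ℂ, 0 < z.im →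
      2 ^ (w + 1) * φ (2 * z) + (1 / 2) * (φ (z / 2) + φ ((z + 1) / 2)) = lam * φ z) (x y : ℂ) :
    lam * evenPeriodIntegral w φ y x = evenPeriodIntegral w φ y (2 * x) +
      evenPeriodIntegral w φ (2 * y) x + evenPeriodIntegral w φ (x + y) (2 * x) -
        evenPeriodIntegral w φ (x + y) (2 * y) := by
  have key (x y : ℂ) : lam * evenPeriodIntegral w φ y x = evenPeriodIntegral w φ y (2 * x) +
      evenPeriodIntegral w φ (2 * y) x + evenPeriodIntegral w φ (2 * y) (x - y) -
        evenPeriodIntegral w φ (2 * x) (x - y) := by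
    have h1 := hφ.periodIntegral_hecke hw heig x y
    have h2 := hφ.periodIntegral_hecke hw heig y x
    have h3 := periodIntegral_neg_neg (φ := φ) hw (2 * y) (y - x)
    have h4 := periodIntegral_neg_neg (φ := φ) hw (2 * x) (y - x)
    rw [neg_sub] at h3 h4
    rw [hφ.evenPeriodIntegral_eq_sub y x, hφ.evenPeriodIntegral_eq_sub y (2 * x),
      hφ.evenPeriodIntegral_eq_sub (2 * y) x, evenPeriodIntegral, evenPeriodIntegral]
    linear_combination (h1 - h2 - h3 + h4) / 2
  have h := key x (-y)
  rw [mul_neg, sub_neg_eq_add, evenPeriodIntegral_neg, evenPeriodIntegral_neg,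
    evenPeriodIntegral_neg, evenPeriodIntegral_neg, hφ.evenPeriodIntegral_swap (x + y) (2 * y),
    hφ.evenPeriodIntegral_swap (x + y) (2 * x)] at h
  linear_combination h

theorem evenPeriodIntegral_eq_sum (hφ : IsCuspFunction w φ) (a b : ℂ) :
    evenPeriodIntegral w φ a b =
      ∑ j ∈ Finset.range (w + 1), evenPeriodCoeff w φ j * (a ^ j * b ^ (w - j)) := by
  rw [evenPeriodIntegral, hφ.periodIntegral_eq_sum, hφ.periodIntegral_eq_sum,
    ← Finset.sum_add_distrib, Finset.sum_div]
  refine Finset.sum_congr rfl fun j _ => ?_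
  rw [evenPeriodCoeff]
  split_ifs with hj
  · rw [hj.neg_pow]
    ring
  · rw [(Nat.not_even_iff_odd.mp hj).neg_pow]
    ring

theorem evenPeriodCoeff_eq_sum (hφ : IsCuspFunction w φ) (hw : Even w) {l : ℕ} (hl : l ≤ w) :
    evenPeriodCoeff w φ l = ∑ j ∈ Finset.range (w + 1),
      evenPeriodCoeff w φ j * ((j.choose l : ℂ) - j.choose (w - l)) := by
  refine coeff_eq_of_forall_sum_eq hl _ _ fun y => ?_
  have h := hφ.evenPeriodIntegral_three_term hw y 1
  simp only [hφ.evenPeriodIntegral_eq_sum, one_pow, mul_one] at h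
  rw [h, ← Finset.sum_sub_distrib]
  exact Finset.sum_congr rfl fun j _ => by ring

theorem evenPeriodCoeff_sub (hφ : IsCuspFunction w φ) (hw : Even w) {l : ℕ} (hl : l ≤ w) :
    evenPeriodCoeff w φ (w - l) = -evenPeriodCoeff w φ l := by
  rw [hφ.evenPeriodCoeff_eq_sum hw hl, hφ.evenPeriodCoeff_eq_sum hw (Nat.sub_le w l),
    Nat.sub_sub_self hl, ← Finset.sum_neg_distrib]
  exact Finset.sum_congr rfl fun j _ => by ring

theorem evenPeriodCoeff_hecke (hφ : IsCuspFunction w φ) (hw : Even w) {lam : ℂ}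
    (heig : ∀ z : ℂ, 0 < z.im →
      2 ^ (w + 1) * φ (2 * z) + (1 / 2) * (φ (z / 2) + φ ((z + 1) / 2)) = lam * φ z)
    {l : ℕ} (hl : l ≤ w) :
    (lam - 2 ^ (w - l) - 2 ^ l) * evenPeriodCoeff w φ l = ∑ j ∈ Finset.range (w + 1),
      2 ^ (w - j) * evenPeriodCoeff w φ j * ((j.choose l : ℂ) - j.choose (w - l)) := by
  refine coeff_eq_of_forall_sum_eq hl
    (fun j => (lam - 2 ^ (w - j) - 2 ^ j) * evenPeriodCoeff w φ j) _ fun y => ?_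
  have h := hφ.evenPeriodIntegral_hecke hw heig 1 y
  simp only [hφ.evenPeriodIntegral_eq_sum, one_pow, mul_one, mul_pow] at h
  rw [Finset.mul_sum, add_sub_assoc, ← sub_eq_iff_eq_add', ← Finset.sum_add_distrib,
    ← Finset.sum_sub_distrib, ← Finset.sum_sub_distrib] at h
  convert h using 1
  · exact Finset.sum_congr rfl fun j _ => by ring
  · exact Finset.sum_congr rfl fun j _ => by ring

theorem sum_evenPeriodCoeff_mul (hφ : IsCuspFunction w φ) (hw : Even w) {lam : ℂ}
    (heig : ∀ z : ℂ, 0 < z.im →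
      2 ^ (w + 1) * φ (2 * z) + (1 / 2) * (φ (z / 2) + φ ((z + 1) / 2)) = lam * φ z)
    {l : ℕ} (hl : l ≤ w) :
    ∑ j ∈ Finset.range (w + 1), evenPeriodCoeff w φ j * (((2 ^ j)⁻¹ - 1) *
      (((2 ^ (w - j))⁻¹ - 1) * (if j = l then 1 else 0) - j.choose l + j.choose (w - l))) =
      (lam - (1 + 2 ^ (w + 1))) / 2 ^ w * evenPeriodCoeff w φ (w - l) := by
  have h1 := hφ.evenPeriodCoeff_eq_sum hw hl
  have h2 := hφ.evenPeriodCoeff_hecke hw heig hl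
  have hpow {j : ℕ} (hj : j ≤ w) : (2 : ℂ) ^ w = 2 ^ j * 2 ^ (w - j) := by
    rw [← pow_add, Nat.add_sub_cancel' hj]
  have hsplit : ∑ j ∈ Finset.range (w + 1), evenPeriodCoeff w φ j * (((2 ^ j)⁻¹ - 1) *
      (((2 ^ (w - j))⁻¹ - 1) * (if j = l then 1 else 0) - j.choose l + j.choose (w - l))) =
      evenPeriodCoeff w φ l * (((2 ^ l)⁻¹ - 1) * ((2 ^ (w - l))⁻¹ - 1))
      - (2 ^ w)⁻¹ * (∑ j ∈ Finset.range (w + 1),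
        2 ^ (w - j) * evenPeriodCoeff w φ j * ((j.choose l : ℂ) - j.choose (w - l)))
      + ∑ j ∈ Finset.range (w + 1),
        evenPeriodCoeff w φ j * ((j.choose l : ℂ) - j.choose (w - l)) := by
    have hdiag : evenPeriodCoeff w φ l * (((2 ^ l)⁻¹ - 1) * ((2 ^ (w - l))⁻¹ - 1)) =
        ∑ j ∈ Finset.range (w + 1), if j = l then
          evenPeriodCoeff w φ j * (((2 ^ j)⁻¹ - 1) * ((2 ^ (w - j))⁻¹ - 1)) else 0 := by
      rw [Finset.sum_ite_eq' _ l, if_pos (Finset.mem_range.mpr (by omega))]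
    rw [hdiag, Finset.mul_sum, ← Finset.sum_sub_distrib, ← Finset.sum_add_distrib]
    refine Finset.sum_congr rfl fun j hj => ?_
    rw [hpow (Nat.lt_succ_iff.mp (Finset.mem_range.mp hj))]
    split_ifs
    · field_simp
      ring
    · field_simp
      ring
  rw [hsplit, ← h1, ← h2, hφ.evenPeriodCoeff_sub hw hl, pow_succ, hpow hl]
  field_simp
  ring

end IsCuspFunction

theorem ichoose_sub (j l : ℕ) : ichoose j ((j : ℤ) - l) = j.choose l := by
  rw [ichoose]
  split_ifs with h
  · rw [show ((j : ℤ) - l).toNat = j - l by omega, Int.toNat_natCast,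
      Nat.choose_symm (show l ≤ j by omega)]
  · rw [Nat.choose_eq_zero_of_lt (by omega), Nat.cast_zero]

theorem c2Entry_eq {w j l : ℕ} (hj : Even j) (hl : Even l) (hw : Even w) (hlw : l ≤ w) :
    c2Entry (j + 1, w - j + 1) (l + 1, w - l + 1) = ((2 ^ j)⁻¹ - 1) *
      (((2 ^ (w - j))⁻¹ - 1) * (if j = l then 1 else 0) - j.choose l + j.choose (w - l)) := by
  have hpow (i : ℕ) : (2 : ℚ) ^ (1 - ((i + 1 : ℕ) : ℤ)) = (2 ^ i)⁻¹ := by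
    rw [show 1 - ((i + 1 : ℕ) : ℤ) = -(i : ℤ) by push_cast; ring, zpow_neg, zpow_natCast]
  have hd : deltaEntry (j + 1, w - j + 1) (l + 1, w - l + 1) = if j = l then 1 else 0 := by
    rw [deltaEntry]
    refine if_congr ?_ rfl rfl
    simp only [Prod.mk.injEq]
    omega
  have hs (i : ℕ) : ((j + 1 : ℕ) : ℤ) - ((i + 1 : ℕ) : ℤ) = (j : ℤ) - i := by push_cast; ring
  have h1 : (-1 : ℚ) ^ ((l + 1 : ℕ) : ℤ) = -1 := by
    rw [zpow_natCast, hl.add_one.neg_one_pow]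
  have h2 : (-1 : ℚ) ^ ((j : ℤ) - (w - l : ℕ)) = 1 := by
    refine Even.neg_one_zpow (Even.sub ?_ ?_)
    · exact_mod_cast hj
    · exact_mod_cast (Nat.even_sub hlw).mpr (iff_of_true hw hl)
  have hj1 : ((j + 1 : ℕ) : ℤ) - 1 = j := by push_cast; ring
  simp only [c2Entry, eEntry, hpow, hd, hs, h1, h2, hj1, ichoose_sub]
  push_cast
  ring

/-- Theorem (connection with the Hecke operator `T₂`): the coefficient vector of the
restricted even period polynomial of a `T₂`-eigenform of weight `k` for `SL(2,ℤ)` is a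
left eigenvector of `C²_{k,2}` with eigenvalue `(λ₂ - (1 + 2^{k-1})) / 2^{k-2}`. -/
theorem stmt0 (k : ℕ) (hk : 6 ≤ k) (hke : Even k) (lam2 : ℂ)
    (f : CuspForm (⊤ : Subgroup (Matrix.SpecialLinearGroup (Fin 2) ℤ)) (k : ℤ))
    (heig : ∀ z : ℂ, 0 < z.im →
      2 ^ (k - 1) * fval f (2 * z) + (1 / 2) * (fval f (z / 2) + fval f ((z + 1) / 2))
        = lam2 * fval f z) :
    ∀ n ∈ oo k, ∑ m ∈ oo k, periodCoeff k f m.1 * (c2Entry m n : ℂ)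
      = ((lam2 - (1 + 2 ^ (k - 1))) / 2 ^ (k - 2)) * periodCoeff k f n.2 := by
  obtain ⟨w, rfl⟩ : ∃ w, k = w + 2 := ⟨k - 2, by omega⟩
  have hw : Even w := by simpa [Nat.even_add] using hke
  have hφ := isCuspFunction_fval w f
  have hcoeff {j : ℕ} (hj : Even j) :
      periodCoeff (w + 2) f (j + 1) = evenPeriodCoeff w (fval f) j := by
    rw [periodCoeff, evenPeriodCoeff, if_pos hj, Nat.add_sub_cancel, Nat.add_sub_cancel]
  rintro ⟨n₁, n₂⟩ hn
  simp only [oo, Finset.mem_filter, Finset.mem_product, Finset.mem_range] at hn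
  obtain ⟨-, hn₁, hn₂, hn₁', hn₂', hsum⟩ := hn
  obtain ⟨l, rfl⟩ : ∃ l, n₁ = l + 1 := ⟨n₁ - 1, by omega⟩
  obtain rfl : n₂ = w - l + 1 := by omega
  have hl : Even l := by simpa [Nat.odd_add_one] using hn₁
  have hlw : Even (w - l) := by simpa [Nat.odd_add_one] using hn₂
  rw [hcoeff hlw, show w + 2 - 1 = w + 1 from rfl, Nat.add_sub_cancel,
    ← hφ.sum_evenPeriodCoeff_mul hw heig (show l ≤ w by omega)]
  rw [← Finset.sum_filter_of_ne (p := fun j => Even j ∧ 2 ≤ j ∧ j + 2 ≤ w)]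
  · refine Finset.sum_nbij' (fun m => m.1 - 1) (fun j => (j + 1, w - j + 1)) ?_ ?_ ?_ ?_ ?_
    · rintro ⟨m₁, m₂⟩ hm
      simp only [oo, Finset.mem_filter, Finset.mem_product, Finset.mem_range] at hm ⊢
      have := hm.2.1.tsub_odd odd_one
      exact ⟨by omega, this, by omega, by omega⟩
    · intro j hj
      simp only [oo, Finset.mem_filter, Finset.mem_product, Finset.mem_range] at hj ⊢
      have := (Nat.even_sub (show j ≤ w by omega)).mpr (iff_of_true hw hj.2.1)
      exact ⟨by omega, hj.2.1.add_one, this.add_one, by omega, by omega, by omega⟩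
    · rintro ⟨m₁, m₂⟩ hm
      simp only [oo, Finset.mem_filter, Finset.mem_product, Finset.mem_range] at hm
      simp only [Prod.mk.injEq]
      omega
    · intro j _
      simp
    · rintro ⟨m₁, m₂⟩ hm
      simp only [oo, Finset.mem_filter, Finset.mem_product, Finset.mem_range] at hm
      obtain ⟨j, rfl⟩ : ∃ j, m₁ = j + 1 := ⟨m₁ - 1, by omega⟩
      obtain rfl : m₂ = w - j + 1 := by omega
      have hj : Even j := by simpa [Nat.odd_add_one] using hm.2.1
      rw [hcoeff hj, c2Entry_eq hj hl hw (by omega)]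
      simp only [Nat.add_sub_cancel]
      split_ifs <;> simp
  · intro j hj hne
    have hjw : j ≤ w := Nat.lt_succ_iff.mp (Finset.mem_range.mp hj)
    have hje : Even j := by
      by_contra h
      simp [evenPeriodCoeff, h] at hne
    refine ⟨hje, ?_, ?_⟩
    · by_contra h
      obtain rfl : j = 0 := by
        rcases hje with ⟨r, hr⟩
        omega
      simp at hne
    · by_contra h
      obtain rfl : j = w := by
        rcases hje with ⟨r, hr⟩
        rcases hw with ⟨s, hs⟩
        omega
      rw [Nat.choose_symm (show l ≤ j by omega)] at hne
      simp at hne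
end
end

section
/- Let k ≥ 6 be an even integer and let f be a cusp form of weight k for SL(2,ℤ) which is an eigenform of the Hecke operator T₃ with eigenvalue λ₃, i.e. 3^{k−1}·f(3z) + (1/3)·(f(z/3) + f((z+1)/3) + f((z+2)/3)) = λ₃·f(z) for all z in the upper half-plane. Then the coefficient vector of the restricted even period polynomial of f is a left eigenvector of the matrix C³_{k,2}: for every pair (n₁,n₂) ∈ oo(k), Σ_{(m₁,m₂)∈oo(k)} a_{m₁,m₂}(f)·c³((m₁,m₂),(n₁,n₂)) = ((λ₃ − (1 + 3^{k−1}))/(4·3^{k−2}))·a_{n₂,n₁}(f). -/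
open Complex MeasureTheory CongruenceSubgroup

noncomputable section

/-- The entry `c³((m₁,m₂),(n₁,n₂))` of the matrix `C³_{k,2}`. -/
def c3Entry (m n : ℕ × ℕ) : ℚ :=
  (((3 : ℚ) ^ (1 - (m.1 : ℤ)) - 1) / 2) *
    ((((3 : ℚ) ^ (1 - (m.2 : ℤ)) - 1) / 2) * deltaEntry m n + eEntry m n)

open Filter Topology Asymptotics

/-- The analytic properties of a level one cusp form of weight `k`, viewed as a function on `ℂ`. -/
structure LevelOneCuspidal (k : ℕ) (F : ℂ → ℂ) : Prop where
  differentiableAt : ∀ z : ℂ, 0 < z.im → DifferentiableAt ℂ F z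
  periodic : Function.Periodic F 1
  inversion : ∀ z : ℂ, 0 < z.im → F (-1 / z) = z ^ k * F z
  decay : ∃ c > 0, ∃ C Y : ℝ, 0 < Y ∧ ∀ z : ℂ, Y ≤ z.im → ‖F z‖ ≤ C * Real.exp (-c * z.im)

lemma im_neg_one_div_pos {z : ℂ} (hz : 0 < z.im) : 0 < (-1 / z).im := by
  have hz0 : z ≠ 0 := by rintro rfl; simp at hz
  have : (-1 / z).im = z.im / normSq z := by
    rw [neg_div, one_div, neg_im, inv_im]; ring
  rw [this]
  exact div_pos hz (normSq_pos.2 hz0)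

lemma levelOneCuspidal_fval {k : ℕ}
    (f : CuspForm (⊤ : Subgroup (Matrix.SpecialLinearGroup (Fin 2) ℤ)) (k : ℤ)) :
    LevelOneCuspidal k (fval f) where
  differentiableAt z hz := by
    have h := (UpperHalfPlane.mdifferentiableAt_iff.1 (f.holo' ⟨z, hz⟩))
    refine h.congr_of_eventuallyEq ?_
    filter_upwards [(isOpen_lt continuous_const continuous_im).mem_nhds hz] with w hw
    have hw' : 0 < w.im := hw
    simp only [fval, hw', dif_pos, Function.comp_apply]
    rw [UpperHalfPlane.ofComplex_apply_of_im_pos hw']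
    rfl
  periodic z := by
    by_cases hz : 0 < z.im
    · have hz1 : 0 < (z + 1).im := by simpa using hz
      rw [fval, fval, dif_pos hz, dif_pos hz1]
      have := SlashInvariantForm.slash_action_eqn_SL'' (Γ := ⊤) f (γ := ModularGroup.T)
        (Subgroup.mem_top _) ⟨z, hz⟩
      rw [UpperHalfPlane.modular_T_smul] at this
      have hd : UpperHalfPlane.denom ModularGroup.T (⟨z, hz⟩ : UpperHalfPlane) = 1 := by
        rw [ModularGroup.denom_apply]
        simp [ModularGroup.T]
      rw [hd, one_zpow, one_mul] at this
      rw [← this]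
      congr 1
      ext
      simp [add_comm]
    · have hz1 : ¬ 0 < (z + 1).im := by simpa using hz
      rw [fval, fval, dif_neg hz, dif_neg hz1]
  inversion z hz := by
    rw [fval, fval, dif_pos hz, dif_pos (im_neg_one_div_pos hz)]
    have := SlashInvariantForm.slash_action_eqn_SL'' (Γ := ⊤) f (γ := ModularGroup.S)
        (Subgroup.mem_top _) ⟨z, hz⟩
    rw [UpperHalfPlane.modular_S_smul, ModularGroup.denom_S,
      zpow_natCast] at this
    rw [← this]
    congr 1
    ext
    simp [neg_div, inv_neg]
  decay := by
    obtain ⟨c, hc, h⟩ := CuspFormClass.exp_decay_atImInfty' f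
    obtain ⟨C, hC⟩ := h.bound
    obtain ⟨Y, hY⟩ := (UpperHalfPlane.atImInfty_mem _).1 hC
    refine ⟨c, hc, C, max Y 1, by positivity, fun z hz => ?_⟩
    have hz0 : 0 < z.im := lt_of_lt_of_le (by positivity) hz
    rw [fval, dif_pos hz0]
    have := hY ⟨z, hz0⟩ ((le_max_left _ _).trans hz)
    simpa using this

lemma exists_hasDerivAt_upperHalfPlane {u : ℂ → ℂ}
    (hu : ∀ z : ℂ, 0 < z.im → DifferentiableAt ℂ u z) :
    ∃ G : ℂ → ℂ, ∀ z : ℂ, 0 < z.im → HasDerivAt G (u z) z := by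
  have him : ∀ w ∈ Metric.ball (0 : ℂ) 1, 1 - w ≠ 0 ∧ 0 < (I * (1 + w) / (1 - w)).im := by
    intro w hw
    have hw1 : ‖w‖ < 1 := by simpa using hw
    have hne : 1 - w ≠ 0 := by
      intro h
      rw [← sub_eq_zero.1 h] at hw1
      simp at hw1
    refine ⟨hne, ?_⟩
    have hsq : w.re * w.re + w.im * w.im < 1 := by
      rw [← normSq_apply, ← Complex.sq_norm]
      nlinarith [norm_nonneg w]
    have : (I * (1 + w) / (1 - w)).im
        = (1 - (w.re * w.re + w.im * w.im)) / normSq (1 - w) := by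
      rw [div_im]
      simp
      ring
    rw [this]
    exact div_pos (by linarith) (normSq_pos.2 hne)
  have hdiff : DifferentiableOn ℂ
      (fun w => u (I * (1 + w) / (1 - w)) * (2 * I / (1 - w) ^ 2)) (Metric.ball 0 1) := by
    intro w hw
    obtain ⟨hne, hpos⟩ := him w hw
    apply DifferentiableAt.differentiableWithinAt
    refine DifferentiableAt.mul ?_ ?_
    · exact DifferentiableAt.comp w (hu _ hpos) (by fun_prop (disch := exact hne))
    · exact DifferentiableAt.div (by fun_prop) (by fun_prop) (pow_ne_zero _ hne)
  obtain ⟨g, hg⟩ := hdiff.isExactOn_ball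
  refine ⟨fun z => g ((z - I) / (z + I)), fun z hz => ?_⟩
  have hzI : z + I ≠ 0 := by
    intro h
    have := congrArg Complex.im h
    simp at this
    linarith
  have hmem : (z - I) / (z + I) ∈ Metric.ball (0 : ℂ) 1 := by
    rw [mem_ball_zero_iff, norm_div, div_lt_one (norm_pos_iff.2 hzI)]
    refine lt_of_pow_lt_pow_left₀ 2 (norm_nonneg _) ?_
    rw [Complex.sq_norm, Complex.sq_norm, normSq_apply, normSq_apply]
    simp
    nlinarith
  have hw : HasDerivAt (fun z : ℂ => (z - I) / (z + I)) (2 * I / (z + I) ^ 2) z := by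
    have := ((hasDerivAt_id z).sub_const I).div ((hasDerivAt_id z).add_const I) hzI
    convert! this using 1
    simp
    ring
  have h1 : 1 - (z - I) / (z + I) = 2 * I / (z + I) := by field_simp; ring
  have h2 : 1 + (z - I) / (z + I) = 2 * z / (z + I) := by field_simp; ring
  convert! (hg _ hmem).comp z hw using 1
  have h3 : I * (2 * z / (z + I)) / (2 * I / (z + I)) = z := by
    field_simp
  beta_reduce
  rw [h1, h2, h3]
  field_simp

namespace LevelOneCuspidal

variable {k : ℕ} {F : ℂ → ℂ}

lemma strip_decay (hF : LevelOneCuspidal k F) (Q : Polynomial ℂ) (M : ℝ) :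
    ∃ c > 0, ∃ C Y : ℝ, 0 < Y ∧ ∀ z : ℂ, |z.re| ≤ M → Y ≤ z.im →
      ‖F z * Q.eval z‖ ≤ C * Real.exp (-c * z.im) := by
  induction Q using Polynomial.induction_on' with
  | add p q hp hq =>
    obtain ⟨c, hc, C, Y, hY, h⟩ := hp
    obtain ⟨c', hc', C', Y', hY', h'⟩ := hq
    refine ⟨min c c', lt_min hc hc', |C| + |C'|, max Y Y', by positivity, fun z hz hz' => ?_⟩
    have hzi : 0 < z.im := lt_of_lt_of_le (by positivity) hz'
    rw [Polynomial.eval_add, mul_add, add_mul]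
    refine (norm_add_le _ _).trans (add_le_add ?_ ?_)
    · refine (h z hz ((le_max_left _ _).trans hz')).trans ?_
      gcongr
      · exact le_abs_self C
      · exact min_le_left _ _
    · refine (h' z hz ((le_max_right _ _).trans hz')).trans ?_
      gcongr
      · exact le_abs_self C'
      · exact min_le_right _ _
  | monomial n a =>
    obtain ⟨c, hc, C, Y, hY, h⟩ := hF.decay
    have hlim := (isLittleO_pow_exp_pos_mul_atTop n (half_pos hc)).bound one_pos
    obtain ⟨Y', hY'⟩ := Filter.eventually_atTop.1 hlim
    refine ⟨c / 2, half_pos hc, |C| * (‖a‖ * (|M| + 1) ^ n), max (max Y Y') 1, by positivity,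
      fun z hz hz' => ?_⟩
    have h1 : 1 ≤ z.im := (le_max_right _ _).trans hz'
    have hYz : Y ≤ z.im := ((le_max_left _ _).trans (le_max_left _ _)).trans hz'
    have hYz' : Y' ≤ z.im := ((le_max_right _ _).trans (le_max_left _ _)).trans hz'
    have hp : z.im ^ n ≤ Real.exp (c / 2 * z.im) := by
      have := hY' z.im hYz'
      rw [Real.norm_of_nonneg (by positivity), Real.norm_of_nonneg (by positivity)] at this
      linarith
    have hn : ‖z‖ ≤ (|M| + 1) * z.im := by
      refine (Complex.norm_le_abs_re_add_abs_im z).trans ?_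
      rw [abs_of_pos (by linarith : 0 < z.im)]
      nlinarith [le_abs_self M, abs_nonneg M]
    have hexp : Real.exp (-(c / 2) * z.im) = Real.exp (-c * z.im) * Real.exp (c / 2 * z.im) := by
      rw [← Real.exp_add]; ring_nf
    rw [Polynomial.eval_monomial, norm_mul, norm_mul, norm_pow]
    calc ‖F z‖ * (‖a‖ * ‖z‖ ^ n)
        ≤ (|C| * Real.exp (-c * z.im)) * (‖a‖ * ((|M| + 1) * z.im) ^ n) := by
          gcongr
          refine (h z hYz).trans ?_
          gcongr
          exact le_abs_self C
      _ = |C| * (‖a‖ * (|M| + 1) ^ n) * (Real.exp (-c * z.im) * z.im ^ n) := by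
          rw [mul_pow]; ring
      _ ≤ _ := by
          rw [hexp]
          gcongr

lemma tendsto_primitive_sub (hF : LevelOneCuspidal k F) {Q : Polynomial ℂ} {G : ℂ → ℂ}
    (hG : ∀ z : ℂ, 0 < z.im → HasDerivAt G (F z * Q.eval z) z) (a b : ℝ) :
    Tendsto (fun T : ℝ => G (a + I * T) - G (b + I * T)) atTop (𝓝 0) := by
  obtain ⟨c, hc, C, Y, hY, h⟩ := hF.strip_decay Q (max |a| |b|)
  have hlim : Tendsto (fun T : ℝ => C * Real.exp (-c * T) * ‖(a : ℂ) - b‖) atTop (𝓝 0) := by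
    have : Tendsto (fun T : ℝ => Real.exp (-c * T)) atTop (𝓝 0) :=
      Real.tendsto_exp_atBot.comp (tendsto_id.const_mul_atTop_of_neg (neg_lt_zero.2 hc))
    simpa using (this.const_mul C).mul_const ‖(a : ℂ) - b‖
  refine squeeze_zero_norm' ?_ hlim
  filter_upwards [eventually_ge_atTop Y] with T hT
  have hconv : Convex ℝ {z : ℂ | |z.re| ≤ max |a| |b| ∧ z.im = T} := by
    have h1 := (convex_Icc (-max |a| |b|) (max |a| |b|)).linear_preimage Complex.reLm
    have h2 := (convex_singleton T).linear_preimage Complex.imLm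
    have : {z : ℂ | |z.re| ≤ max |a| |b| ∧ z.im = T} = Complex.reLm ⁻¹'
        Set.Icc (-max |a| |b|) (max |a| |b|) ∩ Complex.imLm ⁻¹' {T} :=
      Set.ext fun z => by simp [abs_le, -le_sup_iff]
    exact this ▸ h1.inter h2
  have := hconv.norm_image_sub_le_of_norm_hasDerivWithin_le (f := G)
    (f' := fun z => F z * Q.eval z) (C := C * Real.exp (-c * T)) (x := b + I * T) (y := a + I * T)
    (fun z hz => (hG z (by rw [hz.2]; linarith)).hasDerivWithinAt)
    (fun z hz => by
      have := h z hz.1 (by rw [hz.2]; exact hT)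
      rwa [hz.2] at this) (by simp) (by simp)
  simpa using this

lemma add_intCast (hF : LevelOneCuspidal k F) (z : ℂ) (n : ℤ) : F (z + n) = F z := by
  simpa using hF.periodic.int_mul n z

lemma map_div_intCast_mul_add_one (hF : LevelOneCuspidal k F) (hk : Even k) (n : ℤ) {z : ℂ}
    (hz : 0 < z.im) (hn : n * z + 1 ≠ 0) : F (z / (n * z + 1)) = (n * z + 1) ^ k * F z := by
  have hz0 : z ≠ 0 := by rintro rfl; simp at hz
  have him : 0 < (-1 / z + (-n : ℤ)).im := by
    simpa using im_neg_one_div_pos hz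
  have hne : -1 / z + (-n : ℤ) ≠ 0 := by
    intro h
    rw [h] at him
    simp at him
  have h1 : z / (n * z + 1) = -1 / (-1 / z + (-n : ℤ)) := by
    rw [div_eq_div_iff hn hne]
    push_cast
    field_simp
    ring
  have h2 : (-1 / z + (-n : ℤ)) * z = -(n * z + 1) := by
    push_cast
    field_simp
    ring
  rw [h1, hF.inversion _ him, hF.add_intCast, hF.inversion z hz, ← mul_assoc, ← mul_pow, h2,
    hk.neg_pow]

lemma continuousOn_vertical (hF : LevelOneCuspidal k F) (Q : Polynomial ℂ) (x : ℝ) :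
    ContinuousOn (fun t : ℝ => F (x + I * t) * Q.eval (x + I * t)) (Set.Ioi 0) := by
  intro t ht
  have h : DifferentiableAt ℂ F (x + I * t) := hF.differentiableAt _ (by simpa using ht)
  have hc : ContinuousAt (fun t : ℝ => (x + I * t : ℂ)) t := by fun_prop
  exact ((h.continuousAt.comp (f := fun t : ℝ => (x + I * t : ℂ)) hc).mul
    (Q.continuous.continuousAt.comp (f := fun t : ℝ => (x + I * t : ℂ)) hc)).continuousWithinAt

/-- Integrability along the vertical line above a cusp `x`, provided the behaviour of `F` near `x`
is the one at infinity, up to a polynomial automorphy factor `R`. -/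
lemma integrableOn_vertical (hF : LevelOneCuspidal k F) (Q R : Polynomial ℂ) (x a : ℝ) {ρ : ℝ}
    (hρ : 0 < ρ)
    (hR : ∀ t : ℝ, 0 < t → F (x + I * t) = F (a + I * (ρ / t : ℝ)) * R.eval (a + I * (ρ / t : ℝ))) :
    IntegrableOn (fun t : ℝ => F (x + I * t) * Q.eval (x + I * t)) (Set.Ioi 0) := by
  obtain ⟨c, hc, C, Y, hY, h⟩ := hF.strip_decay Q |x|
  obtain ⟨c', hc', C', Y', hY', h'⟩ := hF.strip_decay R |a|
  have hcont := hF.continuousOn_vertical Q x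
  have htop : (fun t : ℝ => F (x + I * t) * Q.eval (x + I * t)) =O[atTop]
      fun t => Real.exp (-c * t) := by
    refine IsBigO.of_bound C ?_
    filter_upwards [eventually_ge_atTop Y] with t ht
    simpa [-norm_mul] using h (x + I * t) (by simp) (by simpa using ht)
  have hzero : (fun t : ℝ => F (x + I * t) * Q.eval (x + I * t)) =O[𝓝[>] 0]
      fun t => t ^ (-(0 : ℝ)) := by
    have hQ : (fun t : ℝ => Q.eval (x + I * t)) =O[𝓝[>] 0] fun _ => (1 : ℝ) := by
      have : ContinuousAt (fun t : ℝ => Q.eval (x + I * t : ℂ)) 0 := by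
        exact Q.continuous.continuousAt.comp (f := fun t : ℝ => (x + I * t : ℂ)) (by fun_prop)
      exact (this.tendsto.isBigO_one ℝ).mono nhdsWithin_le_nhds
    have hFx : (fun t : ℝ => F (x + I * t)) =O[𝓝[>] 0] fun _ => (1 : ℝ) := by
      refine IsBigO.of_bound |C'| ?_
      filter_upwards [Ioo_mem_nhdsGT (div_pos hρ hY')] with t ht
      have hY't : Y' ≤ ρ / t := by
        rw [le_div_iff₀ ht.1, mul_comm, ← le_div_iff₀ hY']
        exact ht.2.le
      rw [hR t ht.1]
      refine (h' _ (by simp) (by simpa using hY't)).trans ?_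
      rw [norm_one]
      gcongr
      · exact le_abs_self C'
      · rw [Real.exp_le_one_iff]
        have : 0 < ρ / t := div_pos hρ ht.1
        simp only [add_im, ofReal_im, mul_im, I_re, I_im, ofReal_re]
        nlinarith
    simpa using hFx.mul hQ
  have := mellinConvergent_of_isBigO_rpow_exp hc
    (hcont.locallyIntegrableOn measurableSet_Ioi) htop hzero (s := 1) (by simp)
  simpa [MellinConvergent] using this

lemma tendsto_primitive_vertical (hF : LevelOneCuspidal k F) {Q : Polynomial ℂ} {G : ℂ → ℂ}
    (hG : ∀ z : ℂ, 0 < z.im → HasDerivAt G (F z * Q.eval z) z) (x : ℝ) {ρ : ℝ} (hρ : 0 < ρ)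
    (hscale : IntegrableOn (fun t : ℝ => F (x + I * t) * Q.eval (x + I * t)) (Set.Ioi 0)) :
    Tendsto (fun T : ℝ => G (x + I * T) - G (x + I * (ρ / T : ℝ))) atTop
      (𝓝 (I * ∫ t in Set.Ioi (0 : ℝ), F (x + I * t) * Q.eval (x + I * t))) := by
  have hρT : Tendsto (fun T : ℝ => ρ / T) atTop (𝓝 0) := tendsto_id.const_div_atTop ρ
  have hcover : AECover (volume.restrict (Set.Ioi (0 : ℝ))) atTop fun T : ℝ => Set.Ioc (ρ / T) T :=
    (aecover_Ioi_of_Ioi hρT).inter ((aecover_Iic tendsto_id).mono Measure.restrict_le_self)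
  have hlim := (hcover.integral_tendsto_of_countably_generated hscale).const_mul I
  refine hlim.congr' ?_
  filter_upwards [eventually_ge_atTop (max 1 ρ)] with T hT
  have h1 : 1 ≤ T := (le_max_left _ _).trans hT
  have h2 : ρ ≤ T := (le_max_right _ _).trans hT
  have hpos : 0 < ρ / T := by positivity
  have hle : ρ / T ≤ T := by
    rw [div_le_iff₀ (by linarith)]
    nlinarith
  have hsub : Set.Ioc (ρ / T) T ⊆ Set.Ioi 0 := fun t ht => hpos.trans ht.1
  rw [Measure.restrict_restrict measurableSet_Ioc, Set.inter_eq_left.2 hsub,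
    ← intervalIntegral.integral_of_le hle, ← intervalIntegral.integral_const_mul]
  have hIcc : Set.uIcc (ρ / T) T ⊆ Set.Ioi 0 := by
    rw [Set.uIcc_of_le hle]
    exact fun t ht => hpos.trans_le ht.1
  refine intervalIntegral.integral_eq_sub_of_hasDerivAt (f := fun t : ℝ => G (x + I * t))
    (fun t ht => ?_) ?_
  · have hd : HasDerivAt (fun t : ℝ => (x + I * t : ℂ)) I t := by
      simpa using ((hasDerivAt_id t).ofReal_comp.const_mul I).const_add (x : ℂ)
    have := (hG (x + I * t) (by simpa using hIcc ht)).comp t hd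
    rwa [mul_comm] at this
  · exact (continuousOn_const.mul ((hF.continuousOn_vertical Q x).mono hIcc)).intervalIntegrable

lemma integrableOn_imaginary_axis (hF : LevelOneCuspidal k F) (Q : Polynomial ℂ) :
    IntegrableOn (fun t : ℝ => F ((0 : ℝ) + I * t) * Q.eval ((0 : ℝ) + I * t)) (Set.Ioi 0) := by
  refine hF.integrableOn_vertical Q (Polynomial.X ^ k) 0 0 one_pos fun t ht => ?_
  have ht0 : (t : ℂ) ≠ 0 := by exact_mod_cast ht.ne'
  have h := hF.inversion (I * (1 / t : ℝ)) (by simpa using ht)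
  have h1 : -1 / (I * (1 / t : ℝ)) = I * t := by
    push_cast
    field_simp
    simp
  rw [h1] at h
  simp only [ofReal_zero, zero_add, Polynomial.eval_pow, Polynomial.eval_X]
  rw [h, mul_comm]

lemma intCast_mul_add_one_ne_zero {n : ℤ} (hn : n ≠ 0) {z : ℂ} (hz : 0 < z.im) :
    (n * z + 1 : ℂ) ≠ 0 := by
  intro h
  have := congrArg Complex.im h
  simp [hn, hz.ne'] at this

lemma div_intCast_mul_add_one_vertical {n : ℤ} (hn : n ≠ 0) {t : ℝ} (ht : 0 < t) :
    (((-1 / n : ℝ) : ℂ) + I * t) / (n * (((-1 / n : ℝ) : ℂ) + I * t) + 1)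
      = ((1 / n : ℝ) : ℂ) + I * (1 / (n : ℝ) ^ 2 / t : ℝ) := by
  have ht0 : (t : ℂ) ≠ 0 := by exact_mod_cast ht.ne'
  have hn0 : (n : ℂ) ≠ 0 := by exact_mod_cast hn
  have h1 : (n * (((-1 / n : ℝ) : ℂ) + I * t) + 1) = n * I * t := by
    push_cast
    field_simp
    ring
  rw [h1]
  push_cast
  field_simp
  linear_combination -I_sq

lemma integrableOn_vertical_one_div (hF : LevelOneCuspidal k F) (hk : Even k) {n : ℤ} (hn : n ≠ 0)
    (Q : Polynomial ℂ) :
    IntegrableOn (fun t : ℝ => F ((1 / n : ℝ) + I * t) * Q.eval (((1 / n : ℝ) : ℂ) + I * t))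
      (Set.Ioi 0) := by
  have hn2 : (0 : ℝ) < 1 / (n : ℝ) ^ 2 := by positivity
  refine hF.integrableOn_vertical Q ((Polynomial.C (n : ℂ) * Polynomial.X + 1) ^ k) (1 / n)
    (-1 / n) hn2 fun t ht => ?_
  have hs : 0 < 1 / (n : ℝ) ^ 2 / t := div_pos hn2 ht
  have him : 0 < (((-1 / n : ℝ) : ℂ) + I * (1 / (n : ℝ) ^ 2 / t : ℝ)).im := by
    simpa only [add_im, ofReal_im, mul_im, I_re, I_im, ofReal_re, zero_mul, zero_add, one_mul]
  have h := hF.map_div_intCast_mul_add_one hk n him (intCast_mul_add_one_ne_zero hn him)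
  rw [div_intCast_mul_add_one_vertical hn hs, div_div_cancel₀ hn2.ne'] at h
  rw [h]
  simp [mul_comm]

lemma hasDerivAt_primitive_inversion (hF : LevelOneCuspidal k F) (hk : 2 ≤ k)
    {P R : Polynomial ℂ} {G : ℂ → ℂ}
    (hG : ∀ z : ℂ, 0 < z.im → HasDerivAt G (F z * P.eval z) z)
    (hR : ∀ z : ℂ, 0 < z.im → z ^ (k - 2) * P.eval (-1 / z) = R.eval z) {z : ℂ} (hz : 0 < z.im) :
    HasDerivAt (fun z => G (-1 / z)) (F z * R.eval z) z := by
  have hz0 : z ≠ 0 := by rintro rfl; simp at hz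
  have hd : HasDerivAt (fun z : ℂ => -1 / z) (1 / z ^ 2) z := by
    convert! (hasDerivAt_inv hz0).neg using 1
    · ext w; simp [neg_div]
    · simp
  convert! (hG _ (im_neg_one_div_pos hz)).comp z hd using 1
  rw [hF.inversion z hz, ← hR z hz, ← Nat.sub_add_cancel hk, pow_add, Nat.add_sub_cancel]
  field_simp

lemma im_div_intCast_mul_add_one_pos {n : ℤ} (hn : n ≠ 0) {z : ℂ} (hz : 0 < z.im) :
    0 < (z / (n * z + 1)).im := by
  have hz0 : z ≠ 0 := by rintro rfl; simp at hz
  have hne := intCast_mul_add_one_ne_zero hn hz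
  have h2 : 0 < (-1 / z + (-n : ℤ)).im := by simpa using im_neg_one_div_pos hz
  have h1 : z / (n * z + 1) = -1 / (-1 / z + (-n : ℤ)) := by
    have : -1 / z + (-n : ℤ) ≠ 0 := by
      intro h
      rw [h] at h2
      simp at h2
    rw [div_eq_div_iff hne this]
    push_cast
    field_simp
    ring
  rw [h1]
  exact im_neg_one_div_pos h2

lemma hasDerivAt_primitive_div (hF : LevelOneCuspidal k F) (hk : 2 ≤ k) (hke : Even k) {n : ℤ}
    (hn : n ≠ 0) {P Q : Polynomial ℂ} {G : ℂ → ℂ}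
    (hG : ∀ z : ℂ, 0 < z.im → HasDerivAt G (F z * P.eval z) z)
    (hQ : ∀ z : ℂ, 0 < z.im → (n * z + 1) ^ (k - 2) * P.eval (z / (n * z + 1)) = Q.eval z)
    {z : ℂ} (hz : 0 < z.im) :
    HasDerivAt (fun z => G (z / (n * z + 1))) (F z * Q.eval z) z := by
  have hne := intCast_mul_add_one_ne_zero hn hz
  have hd : HasDerivAt (fun z : ℂ => z / (n * z + 1)) (1 / (n * z + 1) ^ 2) z := by
    have := (hasDerivAt_id z).div (((hasDerivAt_id z).const_mul (n : ℂ)).add_const 1) hne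
    convert! this using 1
    simp
    ring
  convert! (hG _ (im_div_intCast_mul_add_one_pos hn hz)).comp z hd using 1
  rw [hF.map_div_intCast_mul_add_one hke n hz hne, ← hQ z hz, ← Nat.sub_add_cancel hk, pow_add,
    Nat.add_sub_cancel]
  field_simp

lemma integral_inversion (hF : LevelOneCuspidal k F) (hk : 2 ≤ k) {P R : Polynomial ℂ}
    (hR : ∀ z : ℂ, 0 < z.im → z ^ (k - 2) * P.eval (-1 / z) = R.eval z) :
    ∫ t in Set.Ioi (0 : ℝ), F (I * t) * R.eval (I * t)
      = -∫ t in Set.Ioi (0 : ℝ), F (I * t) * P.eval (I * t) := by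
  obtain ⟨G, hG⟩ := exists_hasDerivAt_upperHalfPlane (u := fun z => F z * P.eval z)
    fun z hz => (hF.differentiableAt z hz).mul P.differentiableAt
  have h1 := hF.tendsto_primitive_vertical hG 0 one_pos (hF.integrableOn_imaginary_axis P)
  have h2 := hF.tendsto_primitive_vertical
    (fun z hz => hF.hasDerivAt_primitive_inversion hk hG hR hz) 0 one_pos
    (hF.integrableOn_imaginary_axis R)
  have h3 := (h1.add h2).congr' (f₂ := fun _ => 0) <| by
    filter_upwards [eventually_gt_atTop 0] with T hT
    have hT0 : (T : ℂ) ≠ 0 := by exact_mod_cast hT.ne'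
    have e1 : -1 / (I * T) = I * (1 / T : ℝ) := by
      push_cast
      field_simp
      simp
    have e2 : -1 / (I * (1 / T : ℝ)) = I * T := by
      push_cast
      field_simp
      simp
    simp only [ofReal_zero, zero_add]
    rw [e1, e2]
    ring
  have h4 := tendsto_nhds_unique h3 tendsto_const_nhds
  rw [← mul_add, mul_eq_zero, or_iff_right I_ne_zero] at h4
  simp only [ofReal_zero, zero_add] at h4
  linear_combination h4

/-- Shifting the line of integration from `1 / n` to the imaginary axis: the geodesic from `0` to
`1 / n` is the image of the imaginary axis under `z ↦ z / (n z + 1)`. -/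
lemma integral_vertical_one_div (hF : LevelOneCuspidal k F) (hk : 2 ≤ k) (hke : Even k) {n : ℤ}
    (hn : n ≠ 0) {P Q R : Polynomial ℂ}
    (hQ : ∀ z : ℂ, 0 < z.im → (n * z + 1) ^ (k - 2) * P.eval (z / (n * z + 1)) = Q.eval z)
    (hR : ∀ z : ℂ, 0 < z.im → z ^ (k - 2) * P.eval (-1 / z) = R.eval z) :
    ∫ t in Set.Ioi (0 : ℝ), F ((1 / n : ℝ) + I * t) * P.eval (((1 / n : ℝ) : ℂ) + I * t)
      = (∫ t in Set.Ioi (0 : ℝ), F (I * t) * P.eval (I * t))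
        - ∫ t in Set.Ioi (0 : ℝ), F (I * t) * Q.eval (I * t) := by
  obtain ⟨G, hG⟩ := exists_hasDerivAt_upperHalfPlane (u := fun z => F z * P.eval z)
    fun z hz => (hF.differentiableAt z hz).mul P.differentiableAt
  have hn2 : (0 : ℝ) < 1 / (n : ℝ) ^ 2 := by positivity
  have hn0 : (n : ℂ) ≠ 0 := by exact_mod_cast hn
  have hGS := fun z hz => hF.hasDerivAt_primitive_inversion hk hG hR (z := z) hz
  have hGg := fun z hz => hF.hasDerivAt_primitive_div hk hke hn hG hQ (z := z) hz
  have h1 := hF.tendsto_primitive_vertical hG 0 one_pos (hF.integrableOn_imaginary_axis P)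
  have h2 := hF.tendsto_primitive_vertical hGg 0 one_pos (hF.integrableOn_imaginary_axis Q)
  have h3 := hF.tendsto_primitive_vertical hG (1 / n) hn2
    (hF.integrableOn_vertical_one_div hke hn P)
  have h4 := hF.tendsto_primitive_sub hG 0 (1 / n)
  have h5 := hF.tendsto_primitive_sub hGS 0 (-n : ℤ)
  have h6 := hF.tendsto_primitive_sub hGg 0 (-1 / n)
  have h7 := (((h1.sub h2).sub h3).sub ((h4.sub h5).sub h6)).congr' (f₂ := fun _ => 0) <| by
    filter_upwards [eventually_gt_atTop 0] with T hT
    have hT0 : (T : ℂ) ≠ 0 := by exact_mod_cast hT.ne'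
    have e1 : -1 / (I * T) = I * (1 / T : ℝ) := by
      push_cast
      field_simp
      simp
    have e2 : -1 / (((-n : ℤ) : ℝ) + I * T) = I * (1 / T : ℝ) / (n * (I * (1 / T : ℝ)) + 1) := by
      have a1 : (((-n : ℤ) : ℝ) + I * T : ℂ) ≠ 0 := by
        intro h
        have := congrArg Complex.im h
        simp [hT.ne'] at this
      have a2 := intCast_mul_add_one_ne_zero hn (z := I * (1 / T : ℝ)) (by simpa using hT)
      rw [div_eq_div_iff a1 a2]
      push_cast
      field_simp
      linear_combination -(T : ℂ) * I_sq
    have e3 := div_intCast_mul_add_one_vertical hn hT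
    simp only [ofReal_zero, zero_add]
    rw [e1, e2, e3]
    ring
  have h8 := tendsto_nhds_unique h7 tendsto_const_nhds
  simp only [sub_zero, ← mul_sub] at h8
  rw [mul_eq_zero, or_iff_right I_ne_zero] at h8
  simp only [ofReal_zero, zero_add] at h8
  linear_combination -h8

end LevelOneCuspidal

/-- The `j`-th moment `∫_0^∞ F(it) (it)^j dt` along the imaginary axis. -/
def moment (F : ℂ → ℂ) (j : ℕ) : ℂ := ∫ t in Set.Ioi (0 : ℝ), F (I * t) * (I * t) ^ j

/-- The integral `∫_0^∞ F(x + it) (it)^j dt` along the vertical line above `x`. -/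
def shiftedMoment (F : ℂ → ℂ) (x : ℝ) (j : ℕ) : ℂ :=
  ∫ t in Set.Ioi (0 : ℝ), F (x + I * t) * (I * t) ^ j

lemma shiftedMoment_zero (F : ℂ → ℂ) (j : ℕ) : shiftedMoment F 0 j = moment F j := by
  simp [shiftedMoment, moment]

lemma shiftedMoment_comp_mul (F : ℂ → ℂ) (x : ℝ) (j : ℕ) {c : ℝ} (hc : 0 < c) :
    ∫ t in Set.Ioi (0 : ℝ), F (x + I * (c * t : ℝ)) * (I * t) ^ j
      = ((c : ℂ) ^ (j + 1))⁻¹ * shiftedMoment F x j := by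
  have h := integral_comp_mul_left_Ioi
    (fun u : ℝ => F (x + I * u) * (I * ((c : ℂ)⁻¹ * u)) ^ j) 0 hc
  have hc0 : (c : ℂ) ≠ 0 := by exact_mod_cast hc.ne'
  rw [mul_zero] at h
  have e1 : ∀ t : ℝ, (I * ((c : ℂ)⁻¹ * ((c * t : ℝ) : ℂ))) ^ j = (I * t) ^ j := fun t => by
    push_cast
    rw [inv_mul_cancel_left₀ hc0]
  simp only [e1] at h
  rw [h, shiftedMoment, ← integral_const_mul, Complex.real_smul, ← integral_const_mul]
  congr 1
  ext t
  rw [pow_succ]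
  push_cast
  field_simp
  rw [mul_assoc, ← mul_pow, div_mul_cancel₀ _ hc0]

namespace LevelOneCuspidal

variable {k : ℕ} {F : ℂ → ℂ}

lemma integrableOn_moment (hF : LevelOneCuspidal k F) (j : ℕ) :
    IntegrableOn (fun t : ℝ => F (I * t) * (I * t) ^ j) (Set.Ioi 0) := by
  simpa using hF.integrableOn_imaginary_axis (Polynomial.X ^ j)

lemma integral_eval_eq_sum_moment (hF : LevelOneCuspidal k F) (Q : Polynomial ℂ) {N : ℕ}
    (hN : Q.natDegree < N) :
    ∫ t in Set.Ioi (0 : ℝ), F (I * t) * Q.eval (I * t)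
      = ∑ j ∈ Finset.range N, Q.coeff j * moment F j := by
  simp only [moment, ← integral_const_mul]
  rw [← integral_finsetSum _ fun j _ => (hF.integrableOn_moment j).const_mul _]
  congr 1
  ext t
  rw [Polynomial.eval_eq_sum_range' hN, Finset.mul_sum]
  exact Finset.sum_congr rfl fun j _ => by ring

lemma integral_one_add_mul_pow (hF : LevelOneCuspidal k F) (c : ℂ) {a N : ℕ} (ha : a < N) :
    ∫ t in Set.Ioi (0 : ℝ), F (I * t) * (1 + Polynomial.C c * Polynomial.X : Polynomial ℂ).eval
        (I * t) ^ a
      = ∑ j ∈ Finset.range N, a.choose j * c ^ j * moment F j := by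
  have hdeg : ((1 + Polynomial.C c * Polynomial.X : Polynomial ℂ) ^ a).natDegree < N := by
    refine lt_of_le_of_lt ?_ ha
    have h1 : (1 + Polynomial.C c * Polynomial.X : Polynomial ℂ).natDegree ≤ 1 := by
      compute_degree
    simpa using Polynomial.natDegree_pow_le_of_le a h1
  have h := hF.integral_eval_eq_sum_moment _ hdeg
  simp only [Polynomial.eval_pow] at h
  rw [h]
  refine Finset.sum_congr rfl fun j _ => ?_
  have : (1 + Polynomial.C c * Polynomial.X : Polynomial ℂ) ^ a
      = ((1 + Polynomial.X) ^ a).comp (Polynomial.C c * Polynomial.X) := by simp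
  rw [this, Polynomial.comp_C_mul_X_coeff, Polynomial.coeff_one_add_X_pow]

lemma moment_eq_neg (hF : LevelOneCuspidal k F) {a b : ℕ} (hab : a + b + 2 = k) (ha : Even a) :
    moment F b = -moment F a := by
  have h := hF.integral_inversion (by omega) (P := Polynomial.X ^ a) (R := Polynomial.X ^ b) <| by
    intro z hz
    have hz0 : z ≠ 0 := by rintro rfl; simp at hz
    have : k - 2 = b + a := by omega
    simp only [Polynomial.eval_pow, Polynomial.eval_X]
    rw [this, pow_add, mul_assoc, ← mul_pow, mul_div_cancel₀ _ hz0, ha.neg_one_pow, mul_one]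
  simpa [moment] using h

lemma neg_pow_mul_shiftedMoment (hF : LevelOneCuspidal k F) (hke : Even k) {a b : ℕ}
    (hab : a + b + 2 = k) {n : ℤ} (hn : n ≠ 0) :
    (-(n : ℂ)) ^ a * shiftedMoment F (1 / n) a
      = ∑ j ∈ Finset.range (k - 1),
        (a.choose j * (-(n : ℂ)) ^ j - b.choose j * (n : ℂ) ^ j) * moment F j := by
  have hn0 : (n : ℂ) ≠ 0 := by exact_mod_cast hn
  have hk2 : k - 2 = b + a := by omega
  have h := hF.integral_vertical_one_div (by omega) hke hn
    (P := (1 + Polynomial.C (-(n : ℂ)) * Polynomial.X) ^ a)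
    (Q := (1 + Polynomial.C (n : ℂ) * Polynomial.X) ^ b)
    (R := Polynomial.X ^ b * (Polynomial.X + Polynomial.C (n : ℂ)) ^ a)
    (fun z hz => by
      have := intCast_mul_add_one_ne_zero hn hz
      simp only [Polynomial.eval_pow, Polynomial.eval_add, Polynomial.eval_mul, Polynomial.eval_C,
        Polynomial.eval_X, Polynomial.eval_one]
      have e : (n * z + 1) * (1 + -n * (z / (n * z + 1))) = 1 := by
        field_simp
        ring
      rw [hk2, pow_add, mul_assoc, ← mul_pow, e, one_pow, mul_one, add_comm])
    (fun z hz => by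
      have hz0 : z ≠ 0 := by rintro rfl; simp at hz
      simp only [Polynomial.eval_pow, Polynomial.eval_add, Polynomial.eval_mul, Polynomial.eval_C,
        Polynomial.eval_X, Polynomial.eval_one]
      have e : z * (1 + -n * (-1 / z)) = z + n := by
        field_simp
      rw [hk2, pow_add, mul_assoc, ← mul_pow, e])
  simp only [Polynomial.eval_pow] at h
  rw [hF.integral_one_add_mul_pow _ (by omega : a < k - 1),
    hF.integral_one_add_mul_pow _ (by omega : b < k - 1), ← Finset.sum_sub_distrib] at h
  simp only [sub_mul]
  rw [← h, shiftedMoment, ← integral_const_mul]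
  congr 1
  ext t
  have e : (1 + Polynomial.C (-(n : ℂ)) * Polynomial.X : Polynomial ℂ).eval
      (((1 / n : ℝ) : ℂ) + I * t) = -n * (I * t) := by
    simp
    field_simp
    ring
  rw [e, mul_pow]
  ring

lemma pow_mul_shiftedMoment_add (hF : LevelOneCuspidal k F) (hke : Even k) {a b : ℕ}
    (hab : a + b + 2 = k) (ha : Even a) {n : ℤ} (hn : n ≠ 0) :
    (n : ℂ) ^ a * (shiftedMoment F (1 / n) a + shiftedMoment F (-1 / n) a)
      = ∑ j ∈ Finset.range (k - 1),
        ((a.choose j : ℂ) - b.choose j) * ((n : ℂ) ^ j + (-(n : ℂ)) ^ j) * moment F j := by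
  have h1 := hF.neg_pow_mul_shiftedMoment hke hab hn
  have h2 := hF.neg_pow_mul_shiftedMoment hke hab (neg_ne_zero.2 hn)
  rw [ha.neg_pow] at h1
  push_cast at h2
  rw [neg_neg, one_div, inv_neg, ← one_div, ← neg_div] at h2
  rw [mul_add, h1, h2, ← Finset.sum_add_distrib]
  exact Finset.sum_congr rfl fun j _ => by ring

lemma shiftedMoment_add_intCast (hF : LevelOneCuspidal k F) (x : ℝ) (m : ℤ) (j : ℕ) :
    shiftedMoment F (x + m) j = shiftedMoment F x j := by
  unfold shiftedMoment
  congr 1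
  ext t
  rw [← hF.add_intCast (x + I * t) m]
  push_cast
  ring_nf

lemma two_mul_moment (hF : LevelOneCuspidal k F) (hke : Even k) {a b : ℕ}
    (hab : a + b + 2 = k) (ha : Even a) :
    2 * moment F a = ∑ j ∈ Finset.range (k - 1),
        ((a.choose j : ℂ) - b.choose j) * (1 ^ j + (-1) ^ j) * moment F j := by
  have h := hF.pow_mul_shiftedMoment_add hke hab ha one_ne_zero
  have h1 := hF.shiftedMoment_add_intCast 0 1 a
  have h2 := hF.shiftedMoment_add_intCast 0 (-1) a
  rw [shiftedMoment_zero] at h1 h2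
  norm_num at h h1 h2
  rw [h1, h2] at h
  norm_num
  rw [← h]
  ring

lemma hecke_three_moment (hF : LevelOneCuspidal k F) (hke : Even k) {a b : ℕ}
    (hab : a + b + 2 = k) (ha : Even a) {lam3 : ℂ}
    (heig : ∀ z : ℂ, 0 < z.im →
      3 ^ (k - 1) * F (3 * z) + (1 / 3) * (F (z / 3) + F ((z + 1) / 3) + F ((z + 2) / 3))
        = lam3 * F z) :
    (lam3 - 3 ^ a - 3 ^ b) * moment F a = ∑ j ∈ Finset.range (k - 1),
        ((a.choose j : ℂ) - b.choose j) * (3 ^ j + (-3) ^ j) * moment F j := by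
  have hscale : ∀ x : ℝ,
      IntegrableOn (fun t : ℝ => F (x + I * t) * (I * t) ^ a) (Set.Ioi 0) →
      ∀ c : ℝ, 0 < c →
      IntegrableOn (fun t : ℝ => F (x + I * (c * t : ℝ)) * (I * t) ^ a) (Set.Ioi 0) := by
    intro x hx c hc
    have hc0 : (c : ℂ) ≠ 0 := by exact_mod_cast hc.ne'
    have h : IntegrableOn (fun t : ℝ => F (x + I * (c * t : ℝ)) * (I * (c * t : ℝ)) ^ a)
        (Set.Ioi 0) :=
      (integrableOn_Ioi_comp_mul_left_iff (fun u : ℝ => F (x + I * u) * (I * u) ^ a) 0 hc).2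
        (by simpa using hx)
    refine (h.const_mul ((c : ℂ) ^ a)⁻¹).congr (ae_of_all _ fun t => ?_)
    push_cast
    rw [mul_left_comm I, mul_pow]
    field_simp
  have hV : ∀ n : ℤ, n ≠ 0 →
      IntegrableOn (fun t : ℝ => F ((1 / n : ℝ) + I * t) * (I * t) ^ a) (Set.Ioi 0) := by
    intro n hn
    have := hF.integrableOn_vertical_one_div hke hn
      ((Polynomial.X - Polynomial.C ((1 / n : ℝ) : ℂ)) ^ a)
    simpa using this
  have h0 : IntegrableOn (fun t : ℝ => F ((0 : ℝ) + I * t) * (I * t) ^ a) (Set.Ioi 0) := by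
    simpa using hF.integrableOn_moment a
  have i1 := hscale _ h0 3 (by norm_num)
  have i2 := hscale _ h0 (1 / 3) (by norm_num)
  have i3 := hscale _ (hV 3 (by norm_num)) (1 / 3) (by norm_num)
  have i4 := hscale _ (hV (-3) (by norm_num)) (1 / 3) (by norm_num)
  have hsum := integral_add (i1.const_mul (3 ^ (k - 1))) (((i2.add i3).add i4).const_mul (1 / 3))
  have hs2 := integral_add (i2.add i3) i4
  have hs3 := integral_add i2 i3
  simp only [Pi.add_apply] at hsum hs2 hs3
  rw [integral_const_mul, integral_const_mul, hs2, hs3, shiftedMoment_comp_mul _ _ _ (by norm_num),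
    shiftedMoment_comp_mul _ _ _ (by norm_num), shiftedMoment_comp_mul _ _ _ (by norm_num),
    shiftedMoment_comp_mul _ _ _ (by norm_num), shiftedMoment_zero] at hsum
  have hL : lam3 * moment F a = ∫ t in Set.Ioi (0 : ℝ),
      3 ^ (k - 1) * (F ((0 : ℝ) + I * (3 * t : ℝ)) * (I * t) ^ a) + 1 / 3 *
        (F ((0 : ℝ) + I * (1 / 3 * t : ℝ)) * (I * t) ^ a
          + F ((1 / (3 : ℤ) : ℝ) + I * (1 / 3 * t : ℝ)) * (I * t) ^ a
          + F ((1 / (-3 : ℤ) : ℝ) + I * (1 / 3 * t : ℝ)) * (I * t) ^ a) := by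
    rw [moment, ← integral_const_mul]
    refine setIntegral_congr_fun measurableSet_Ioi fun t ht => ?_
    have h := heig (I * t) (by simpa using ht)
    have e1 : (3 * (I * t) : ℂ) = (0 : ℝ) + I * (3 * t : ℝ) := by push_cast; ring
    have e2 : (I * t / 3 : ℂ) = (0 : ℝ) + I * (1 / 3 * t : ℝ) := by push_cast; ring
    have e3 : ((I * t + 1) / 3 : ℂ) = (1 / (3 : ℤ) : ℝ) + I * (1 / 3 * t : ℝ) := by
      push_cast; ring
    have e4 : ((I * t + 2) / 3 : ℂ)
        = (1 / (-3 : ℤ) : ℝ) + I * (1 / 3 * t : ℝ) + (1 : ℤ) := by push_cast; ring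
    rw [e1, e2, e3, e4, hF.add_intCast] at h
    rw [← mul_assoc, ← h]
    ring
  have h3 := hF.pow_mul_shiftedMoment_add hke hab ha (n := 3) (by norm_num)
  have e5 : (-1 / (3 : ℤ) : ℝ) = 1 / (-3 : ℤ) := by norm_num
  rw [e5] at h3
  have hk1 : k - 1 = a + b + 1 := by omega
  have hM := hL.trans hsum
  have e6 : (((1 / 3 : ℝ) : ℂ) ^ (a + 1))⁻¹ = 3 ^ a * 3 := by simp [pow_succ, mul_comm]
  have e7 : (3 ^ (k - 1) * (((3 : ℝ) : ℂ) ^ (a + 1))⁻¹ : ℂ) = 3 ^ b := by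
    rw [hk1, add_right_comm, pow_add _ (a + 1)]
    push_cast
    exact mul_div_cancel_left₀ _ (pow_ne_zero _ three_ne_zero)
  rw [e6, ← mul_assoc, e7] at hM
  simp only [Int.cast_ofNat] at h3 hM
  rw [← h3]
  linear_combination hM

end LevelOneCuspidal

lemma mem_oo {k : ℕ} {m : ℕ × ℕ} :
    m ∈ oo k ↔ Odd m.1 ∧ Odd m.2 ∧ 3 ≤ m.1 ∧ 3 ≤ m.2 ∧ m.1 + m.2 = k := by
  simp only [oo, Finset.mem_filter, Finset.mem_product, Finset.mem_range]
  constructor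
  · exact fun h => h.2
  · exact fun h => ⟨by omega, h⟩

lemma sum_oo_eq_sum_range {k : ℕ} (hk : 2 ≤ k) (hke : Even k) (g : ℕ → ℂ)
    (hodd : ∀ j, Odd j → g j = 0)
    (h0 : g 0 = 0) (hw : g (k - 2) = 0) :
    ∑ m ∈ oo k, g (m.2 - 1) = ∑ j ∈ Finset.range (k - 1), g j := by
  refine Finset.sum_of_injOn (fun m => m.2 - 1) ?_ ?_ ?_ fun _ _ => rfl
  · intro m hm m' hm' h
    simp only [Finset.mem_coe, mem_oo] at hm hm'
    simp only at h
    ext <;> omega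
  · intro m hm
    simp only [Finset.mem_coe, mem_oo, Finset.mem_range] at hm ⊢
    omega
  · intro j hj hj'
    by_contra hg
    refine hj' ⟨(k - (j + 1), j + 1), ?_, by simp⟩
    have hje : Even j := by
      by_contra h
      exact hg (hodd j (Nat.not_even_iff_odd.1 h))
    have hj0 : j ≠ 0 := fun h => hg (h ▸ h0)
    have hjw : j ≠ k - 2 := fun h => hg (h ▸ hw)
    rw [Finset.mem_range] at hj
    simp only [Finset.mem_coe, mem_oo]
    grind

lemma ichoose_sub_one_sub (a b : ℕ) (ha : 1 ≤ a) (hb : 1 ≤ b) :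
    ichoose ((a : ℤ) - 1) ((a : ℤ) - b) = ((a - 1).choose (b - 1) : ℕ) := by
  unfold ichoose
  split_ifs with h
  · have h1 : ((a : ℤ) - 1).toNat = a - 1 := by omega
    have h2 : ((a : ℤ) - b).toNat = (a - 1) - (b - 1) := by omega
    rw [h1, h2, Nat.choose_symm (by omega)]
  · rw [Nat.choose_eq_zero_of_lt (by omega)]
    rfl

lemma eEntry_eq {k : ℕ} {m n : ℕ × ℕ} (hm : m ∈ oo k) (hn : n ∈ oo k) :
    eEntry m n = (m.1 - 1).choose (n.2 - 1) - (m.1 - 1).choose (n.1 - 1) := by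
  rw [mem_oo] at hm hn
  rw [eEntry, ichoose_sub_one_sub _ _ (by omega) (by omega),
    ichoose_sub_one_sub _ _ (by omega) (by omega), Odd.neg_one_zpow (by exact_mod_cast hn.1),
    Even.neg_one_zpow (Odd.sub_odd (by exact_mod_cast hm.1) (by exact_mod_cast hn.2.1))]
  push_cast
  ring

lemma periodCoeff_succ (k : ℕ) (f : UpperHalfPlane → ℂ) (j : ℕ) :
    periodCoeff k f (j + 1) = (k - 2).choose j * I * moment (fval f) j := by
  simp only [periodCoeff, moment, Nat.add_sub_cancel, mul_pow, mul_left_comm _ (I ^ j),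
    integral_const_mul]
  ring

lemma four_mul_c3Entry {k : ℕ} {m : ℕ × ℕ} (hm : m ∈ oo k) (n : ℕ × ℕ) :
    4 * 3 ^ (k - 2) * c3Entry m n
      = (1 - 3 ^ (m.1 - 1)) * (1 - 3 ^ (m.2 - 1)) * deltaEntry m n
        + 2 * (3 ^ (m.2 - 1) - 3 ^ (k - 2)) * eEntry m n := by
  rw [mem_oo] at hm
  obtain ⟨p, hp⟩ : ∃ p, m.1 = p + 1 := ⟨m.1 - 1, by omega⟩
  obtain ⟨q, hq⟩ : ∃ q, m.2 = q + 1 := ⟨m.2 - 1, by omega⟩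
  have hw : k - 2 = p + q := by omega
  have e : ∀ r : ℕ, (3 : ℚ) ^ (1 - ((r + 1 : ℕ) : ℤ)) = (3 ^ r)⁻¹ := fun r => by
    rw [← zpow_natCast, ← zpow_neg]
    congr 1
    push_cast
    ring
  rw [c3Entry, hp, hq, hw, e, e, Nat.add_sub_cancel, Nat.add_sub_cancel, pow_add]
  field_simp
  ring

lemma choose_mul_choose_of_add_eq {i j a b : ℕ} (h : i + j = a + b) :
    (a + b).choose i * i.choose a = (a + b).choose a * b.choose j := by
  obtain hai | hia := le_or_gt a i
  · rw [Nat.choose_mul hai, Nat.add_sub_cancel_left,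
      Nat.choose_symm_of_eq_add (by omega : b = i - a + j)]
  · rw [Nat.choose_eq_zero_of_lt hia, Nat.choose_eq_zero_of_lt (by omega : b < j),
      mul_zero, mul_zero]

lemma sum_periodCoeff_mul_eEntry {k : ℕ} {f : UpperHalfPlane → ℂ}
    (hF : LevelOneCuspidal k (fval f)) (hke : Even k) {n : ℕ × ℕ} (hn : n ∈ oo k) (N : ℂ) :
    2 * ∑ m ∈ oo k, periodCoeff k f m.1 * N ^ (m.2 - 1) * (eEntry m n : ℂ)
      = (k - 2).choose (n.2 - 1) * I * ∑ j ∈ Finset.range (k - 1),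
        (((n.2 - 1).choose j : ℂ) - (n.1 - 1).choose j) * (N ^ j + (-N) ^ j)
          * moment (fval f) j := by
  have hn' := mem_oo.1 hn
  obtain ⟨a, ha⟩ : ∃ a, n.2 = a + 1 := ⟨n.2 - 1, by omega⟩
  obtain ⟨b, hb⟩ : ∃ b, n.1 = b + 1 := ⟨n.1 - 1, by omega⟩
  have hw : k - 2 = a + b := by omega
  rw [Finset.mul_sum, Finset.mul_sum, ha, hb, Nat.add_sub_cancel, Nat.add_sub_cancel,
    ← sum_oo_eq_sum_range (by omega) hke]
  · refine Finset.sum_congr rfl fun m hm => ?_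
    have hm' := mem_oo.1 hm
    rw [eEntry_eq hm hn, ha, hb, Nat.add_sub_cancel, Nat.add_sub_cancel]
    obtain ⟨i, hi⟩ : ∃ i, m.1 = i + 1 := ⟨m.1 - 1, by omega⟩
    obtain ⟨j, hj⟩ : ∃ j, m.2 = j + 1 := ⟨m.2 - 1, by omega⟩
    have hje : Even j := by grind
    have hM := hF.moment_eq_neg (a := j) (b := i) (by omega) hje
    rw [hi, hj, Nat.add_sub_cancel, Nat.add_sub_cancel, periodCoeff_succ, hM, hje.neg_pow, hw]
    have hij : i + j = a + b := by omega
    have c1 : ((a + b).choose i : ℂ) * i.choose a = (a + b).choose a * b.choose j := by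
      exact_mod_cast choose_mul_choose_of_add_eq hij
    have c2 : ((a + b).choose i : ℂ) * i.choose b = (a + b).choose a * a.choose j := by
      rw [Nat.choose_symm_add, add_comm a b]
      exact_mod_cast choose_mul_choose_of_add_eq (by omega : i + j = b + a)
    push_cast
    linear_combination 2 * I * moment (fval f) j * N ^ j * (c2 - c1)
  · intro j hj
    simp [hj.neg_pow]
  · simp
  · rw [Nat.choose_eq_zero_of_lt (by omega : a < k - 2),
      Nat.choose_eq_zero_of_lt (by omega : b < k - 2)]
    simp

/-- Theorem (connection with the Hecke operator `T₃`): the coefficient vector of the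
restricted even period polynomial of a `T₃`-eigenform of weight `k` for `SL(2,ℤ)` is a
left eigenvector of `C³_{k,2}` with eigenvalue `(λ₃ - (1 + 3^{k-1})) / (4 ⬝ 3^{k-2})`. -/
theorem stmt1 (k : ℕ) (hk : 6 ≤ k) (hke : Even k) (lam3 : ℂ)
    (f : CuspForm (⊤ : Subgroup (Matrix.SpecialLinearGroup (Fin 2) ℤ)) (k : ℤ))
    (heig : ∀ z : ℂ, 0 < z.im →
      3 ^ (k - 1) * fval f (3 * z) +
        (1 / 3) * (fval f (z / 3) + fval f ((z + 1) / 3) + fval f ((z + 2) / 3))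
        = lam3 * fval f z) :
    ∀ n ∈ oo k, ∑ m ∈ oo k, periodCoeff k f m.1 * (c3Entry m n : ℂ)
      = ((lam3 - (1 + 3 ^ (k - 1))) / (4 * 3 ^ (k - 2))) * periodCoeff k f n.2 := by
  intro n hn
  have hF := levelOneCuspidal_fval f
  have hn' := mem_oo.1 hn
  have hE1 := sum_periodCoeff_mul_eEntry hF hke hn 1
  have hE3 := sum_periodCoeff_mul_eEntry hF hke hn 3
  obtain ⟨a, ha⟩ : ∃ a, n.2 = a + 1 := ⟨n.2 - 1, by omega⟩
  obtain ⟨b, hb⟩ : ∃ b, n.1 = b + 1 := ⟨n.1 - 1, by omega⟩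
  have hab : a + b + 2 = k := by omega
  have hae : Even a := by grind
  rw [ha, hb, Nat.add_sub_cancel, Nat.add_sub_cancel] at hE1 hE3
  rw [← hF.two_mul_moment hke hab hae] at hE1
  rw [← hF.hecke_three_moment hke hab hae heig] at hE3
  have hδ : ∑ m ∈ oo k, periodCoeff k f m.1 * ((1 - 3 ^ (m.1 - 1)) * (1 - 3 ^ (m.2 - 1))
      * (deltaEntry m n : ℂ)) = -(periodCoeff k f n.2 * ((1 - 3 ^ a) * (1 - 3 ^ b))) := by
    rw [Finset.sum_eq_single_of_mem n hn fun m _ hmn => by simp [deltaEntry, hmn], ha, hb,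
      periodCoeff_succ, periodCoeff_succ, hF.moment_eq_neg hab hae,
      Nat.choose_symm_of_eq_add (by omega : k - 2 = b + a)]
    simp only [Nat.add_sub_cancel, deltaEntry, if_true]
    push_cast
    ring
  have hterm : ∀ m ∈ oo k, 4 * 3 ^ (k - 2) * (periodCoeff k f m.1 * (c3Entry m n : ℂ))
      = periodCoeff k f m.1 * ((1 - 3 ^ (m.1 - 1)) * (1 - 3 ^ (m.2 - 1)) * (deltaEntry m n : ℂ))
        + 2 * (periodCoeff k f m.1 * 3 ^ (m.2 - 1) * (eEntry m n : ℂ))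
        - 3 ^ (k - 2) * (2 * (periodCoeff k f m.1 * 1 ^ (m.2 - 1) * (eEntry m n : ℂ))) := by
    intro m hm
    have h := congrArg (fun q : ℚ => (q : ℂ)) (four_mul_c3Entry hm n)
    push_cast at h
    rw [one_pow]
    linear_combination periodCoeff k f m.1 * h
  have hsum := Finset.sum_congr rfl hterm
  rw [← Finset.mul_sum, Finset.sum_sub_distrib, Finset.sum_add_distrib, ← Finset.mul_sum,
    ← Finset.mul_sum, ← Finset.mul_sum, hδ, hE1, hE3, ha, periodCoeff_succ] at hsum
  have h3 : (4 * 3 ^ (k - 2) : ℂ) ≠ 0 := mul_ne_zero (by norm_num) (pow_ne_zero _ three_ne_zero)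
  rw [ha, periodCoeff_succ, div_mul_eq_mul_div, eq_div_iff h3, mul_comm, hsum]
  have hk1 : k - 1 = a + b + 1 := by omega
  have hk2 : k - 2 = a + b := by omega
  rw [hk1, hk2, pow_succ, pow_add]
  ring
end
end

section
/- Let k ≥ 6 be an even integer, let f be a cusp form of weight k for Γ₀(2), and let ε ∈ {1, −1} be such that f is an Atkin–Lehner eigenform, i.e. 2^{−k/2}·z^{−k}·f(−1/(2z)) = ε·f(z) for all z in the upper half-plane, and f satisfies the newform relation (1/2)·(f(z/2) + f((z+1)/2)) = −ε·2^{(k−2)/2}·f(z) for all z in the upper half-plane. Then for every pair (n₁,n₂) ∈ oo(k), Σ_{(m₁,m₂)∈oo(k)} a_{m₁,m₂}(f)·dc²((m₁,m₂),(n₁,n₂)) = −(1 + ε·2^{−(k−2)/2})·a_{n₂,n₁}(f). -/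
open Complex MeasureTheory CongruenceSubgroup

noncomputable section

/-- The entry `dc²((m₁,m₂),(n₁,n₂))` of the matrix `D²_{k,2} ⬝ C²_{k,2}`. -/
def dc2Entry (m n : ℕ × ℕ) : ℚ :=
  ((2 : ℚ) ^ (1 - (m.2 : ℤ)) - 1) * deltaEntry m n + eEntry m n

open Filter Topology Asymptotics Polynomial

/-- A holomorphic function on the upper half-plane has a primitive there. -/
lemma DifferentiableOn.exists_primitive_upperHalfPlane {h : ℂ → ℂ}
    (hh : DifferentiableOn ℂ h {z | 0 < z.im}) :
    ∃ F : ℂ → ℂ, ∀ z : ℂ, 0 < z.im → HasDerivAt F (h z) z := by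
  have him : ∀ w ∈ Metric.ball (0 : ℂ) 1, 1 - w ≠ 0 ∧ 0 < (I * (1 + w) / (1 - w)).im := by
    intro w hw
    have hw1 : ‖w‖ < 1 := by simpa using hw
    have hne : 1 - w ≠ 0 := by
      intro h0
      rw [sub_eq_zero] at h0
      simp [← h0] at hw1
    refine ⟨hne, ?_⟩
    have hn : 0 < normSq (1 - w) := normSq_pos.2 hne
    have hsq : w.re * w.re + w.im * w.im < 1 := by
      have := normSq_eq_norm_sq w
      rw [normSq_apply] at this
      rw [this]
      exact pow_lt_one₀ (norm_nonneg _) hw1 two_ne_zero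
    have : (I * (1 + w) / (1 - w)).im = (1 - (w.re * w.re + w.im * w.im)) / normSq (1 - w) := by
      simp [div_im]
      field_simp
      ring
    rw [this]
    exact div_pos (by linarith) hn
  have hg : DifferentiableOn ℂ (fun w : ℂ => h (I * (1 + w) / (1 - w)) * (2 * I / (1 - w) ^ 2))
      (Metric.ball 0 1) := by
    refine DifferentiableOn.mul ?_ ?_
    · refine hh.comp (t := {z : ℂ | 0 < z.im}) ?_ fun w hw => (him w hw).2
      exact DifferentiableOn.div (by fun_prop) (by fun_prop) fun w hw => (him w hw).1
    · exact DifferentiableOn.div (by fun_prop) (by fun_prop)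
        fun w hw => pow_ne_zero _ (him w hw).1
  obtain ⟨G, hG⟩ := hg.isExactOn_ball
  refine ⟨fun z => G ((z - I) / (z + I)), fun z hz => ?_⟩
  have hzI : z + I ≠ 0 := by
    intro h0
    have := congrArg Complex.im h0
    simp at this
    linarith
  have hball : (z - I) / (z + I) ∈ Metric.ball (0 : ℂ) 1 := by
    rw [mem_ball_zero_iff, norm_div, div_lt_one (norm_pos_iff.2 hzI),
      ← sq_lt_sq₀ (norm_nonneg _) (norm_nonneg _), ← normSq_eq_norm_sq, ← normSq_eq_norm_sq,
      normSq_apply, normSq_apply]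
    simp
    nlinarith
  have hC : HasDerivAt (fun z : ℂ => (z - I) / (z + I)) (2 * I / (z + I) ^ 2) z := by
    convert! ((hasDerivAt_id z).sub_const I).div ((hasDerivAt_id z).add_const I) hzI using 1
    simp
    ring
  have h1 : 1 - (z - I) / (z + I) = 2 * I / (z + I) := by field_simp; ring
  have h2 : I * (1 + (z - I) / (z + I)) / (1 - (z - I) / (z + I)) = z := by
    rw [h1]; field_simp; ring
  have := (hG _ hball).comp z hC
  convert! this using 1
  beta_reduce
  rw [h2, h1]
  have := I_ne_zero
  field_simp

/-- The filter of points of the strip `|re z| ≤ 1` going to `i∞`. -/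
def stripAtImInfty : Filter ℂ := comap Complex.im atTop ⊓ 𝓟 {z | |z.re| ≤ 1}

lemma tendsto_im_stripAtImInfty : Tendsto Complex.im stripAtImInfty atTop :=
  tendsto_comap.mono_left inf_le_left

lemma isBigO_id_im : (fun z : ℂ => z) =O[stripAtImInfty] fun z => z.im := by
  refine IsBigO.of_bound 2 ?_
  have h1 : ∀ᶠ z in stripAtImInfty, |z.re| ≤ 1 := mem_inf_of_right (mem_principal_self _)
  filter_upwards [h1, tendsto_im_stripAtImInfty.eventually_ge_atTop 1] with z hz hz1
  have := Complex.norm_le_abs_re_add_abs_im z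
  rw [Real.norm_eq_abs]
  have : 1 ≤ |z.im| := hz1.trans (le_abs_self _)
  linarith

/-- If `h` tends to `0` at `i∞` in a vertical strip, then the integrals of `h` along horizontal
segments of the strip tend to `0`. -/
lemma tendsto_primitive_sub_atTop {G h : ℂ → ℂ} (hG : ∀ z : ℂ, 0 < z.im → HasDerivAt G (h z) z)
    (hh : Tendsto h stripAtImInfty (𝓝 0)) {x y : ℝ} (hx : |x| ≤ 1) (hy : |y| ≤ 1) :
    Tendsto (fun T : ℝ => G (y + T * I) - G (x + T * I)) atTop (𝓝 0) := by
  rw [Metric.tendsto_nhds]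
  intro ε hε
  have h1 : ∀ᶠ z in stripAtImInfty, ‖h z‖ ≤ ε / 4 := by
    filter_upwards [(Metric.tendsto_nhds.1 hh) (ε / 4) (by positivity)] with z hz
    simpa using hz.le
  rw [stripAtImInfty, eventually_inf_principal, eventually_comap] at h1
  filter_upwards [h1, eventually_gt_atTop 0] with T hT hT0
  have hconv : Convex ℝ {z : ℂ | z.im = T ∧ |z.re| ≤ 1} := by
    have e : {z : ℂ | z.im = T ∧ |z.re| ≤ 1}
        = Complex.imCLM ⁻¹' {T} ∩ Complex.reCLM ⁻¹' Set.Icc (-1) 1 := by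
      ext z; simp [abs_le]
    rw [e]
    exact ((convex_singleton T).linear_preimage Complex.imCLM.toLinearMap).inter
      ((convex_Icc (-1 : ℝ) 1).linear_preimage Complex.reCLM.toLinearMap)
  have := hconv.norm_image_sub_le_of_norm_hasDerivWithin_le (𝕜 := ℂ) (f := G) (f' := h)
    (C := ε / 4) (x := (x + T * I : ℂ)) (y := (y + T * I : ℂ))
    (fun z hz => (hG z (by rw [hz.1]; exact hT0)).hasDerivWithinAt)
    (fun z hz => hT z hz.1 hz.2) (by simpa using hx) (by simpa using hy)
  rw [dist_zero_right]
  refine this.trans_lt ?_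
  have e : (y + T * I - (x + T * I) : ℂ) = ((y - x : ℝ) : ℂ) := by push_cast; ring
  rw [e, norm_real, Real.norm_eq_abs]
  have : |y - x| ≤ 2 := (abs_sub _ _).trans (by linarith)
  nlinarith

lemma tendsto_sub_integral_Ioi {G g : ℝ → ℂ} (hG : ∀ t : ℝ, 0 < t → HasDerivAt G (g t) t)
    (hg : IntegrableOn g (Set.Ioi 0)) {a b : ℝ → ℝ} (ha : Tendsto a atTop (𝓝[>] 0))
    (hb : Tendsto b atTop atTop) :
    Tendsto (fun T => G (b T) - G (a T)) atTop (𝓝 (∫ t in Set.Ioi (0 : ℝ), g t)) := by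
  obtain ⟨ha0, hapos⟩ := tendsto_nhdsWithin_iff.1 ha
  have hcov : AECover (volume.restrict (Set.Ioi (0 : ℝ))) atTop
      fun T => Set.Ioi (a T) ∩ Set.Iic (b T) :=
    (aecover_Ioi_of_Ioi ha0).inter ((aecover_Iic hb).mono Measure.restrict_le_self)
  refine (hcov.integral_tendsto_of_countably_generated hg).congr' ?_
  filter_upwards [hapos, ha0.eventually (gt_mem_nhds one_pos), hb.eventually_ge_atTop 1]
    with T hT hT1 hT2
  have hT : 0 < a T := hT
  have hab : a T ≤ b T := hT1.le.trans hT2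
  have hsub : Set.Ioc (a T) (b T) ⊆ Set.Ioi 0 := fun t ht => hT.trans ht.1
  rw [Set.Ioi_inter_Iic, Measure.restrict_restrict measurableSet_Ioc,
    Set.inter_eq_left.2 hsub, ← intervalIntegral.integral_of_le hab]
  refine intervalIntegral.integral_eq_sub_of_hasDerivAt (fun t ht => hG t ?_) ?_
  · rw [Set.uIcc_of_le hab] at ht
    exact hT.trans_le ht.1
  · rw [intervalIntegrable_iff_integrableOn_Ioc_of_le hab]
    exact hg.mono_set hsub

/-- A holomorphic function on the upper half-plane with exponential decay at `i∞`, transforming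
with weight `w + 2` under the Fricke involution of level `2` and under `z ↦ z / (± 2 z + 1)`, and
satisfying the relation of newforms of level `2` with scaled Fricke eigenvalue `e`. -/
structure IsFrickeNewform (w : ℕ) (e : ℂ) (φ : ℂ → ℂ) : Prop where
  differentiableOn : DifferentiableOn ℂ φ {z | 0 < z.im}
  decay : ∃ c > 0, φ =O[comap Complex.im atTop] fun z => Real.exp (-c * z.im)
  fricke : ∀ z : ℂ, 0 < z.im → φ (-1 / (2 * z)) = 2 * e * z ^ (w + 2) * φ z
  lower : ∀ σ : ℝ, σ = 1 ∨ σ = -1 → ∀ z : ℂ, 0 < z.im →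
    φ (z / (2 * σ * z + 1)) = (2 * σ * z + 1) ^ (w + 2) * φ z
  half : ∀ σ : ℝ, σ = 1 ∨ σ = -1 → ∀ z : ℂ, 0 < z.im →
    φ ((z + σ) / 2) = -2 * e * φ z - φ (z / 2)

namespace IsFrickeNewform

variable {w : ℕ} {e : ℂ} {φ : ℂ → ℂ}

lemma tendsto_mul_eval (hφ : IsFrickeNewform w e φ) (Q : ℂ[X]) :
    Tendsto (fun z => φ z * Q.eval z) stripAtImInfty (𝓝 0) := by
  obtain ⟨c, hc, hdec⟩ := hφ.decay
  have hmon (n : ℕ) : Tendsto (fun z => φ z * z ^ n) stripAtImInfty (𝓝 0) := by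
    have h1 := (hdec.mono (show stripAtImInfty ≤ _ from inf_le_left)).mul (isBigO_id_im.pow n)
    refine h1.trans_tendsto ?_
    have h2 : Tendsto (fun x : ℝ => Real.exp (-c * x) * x ^ n) atTop (𝓝 0) := by
      have := (isLittleO_pow_exp_pos_mul_atTop n hc).tendsto_div_nhds_zero
      refine this.congr fun x => ?_
      rw [neg_mul, Real.exp_neg]
      field_simp
    exact h2.comp tendsto_im_stripAtImInfty
  have : (fun z => φ z * Q.eval z)
      = fun z => ∑ i ∈ Finset.range (Q.natDegree + 1), Q.coeff i * (φ z * z ^ i) := by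
    ext z
    rw [eval_eq_sum_range, Finset.mul_sum]
    exact Finset.sum_congr rfl fun i _ => by ring
  rw [this]
  simpa using tendsto_finsetSum (Finset.range (Q.natDegree + 1))
    fun i _ => (hmon i).const_mul (Q.coeff i)

lemma tendsto_I_mul_stripAtImInfty : Tendsto (fun t : ℝ => I * t) atTop stripAtImInfty := by
  refine tendsto_inf.2 ⟨tendsto_comap_iff.2 ?_, tendsto_principal.2 ?_⟩
  · exact tendsto_id.congr fun t => by simp
  · exact Eventually.of_forall fun t => by simp

lemma integrableOn_pow (hφ : IsFrickeNewform w e φ) (j : ℕ) :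
    IntegrableOn (fun t : ℝ => φ (I * t) * (t : ℂ) ^ j) (Set.Ioi 0) := by
  have hcont : ContinuousOn (fun t : ℝ => φ (I * t)) (Set.Ioi 0) :=
    hφ.differentiableOn.continuousOn.comp (by fun_prop) fun t ht => by simpa using ht
  have hzero : Tendsto (fun t : ℝ => φ (I * t)) (𝓝[>] 0) (𝓝 0) := by
    have h1 : Tendsto (fun t : ℝ => (2 * t)⁻¹) (𝓝[>] 0) atTop := by
      refine tendsto_inv_nhdsGT_zero.comp (tendsto_nhdsWithin_iff.2 ⟨?_, ?_⟩)
      · exact tendsto_nhdsWithin_of_tendsto_nhds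
          (Continuous.tendsto' (by fun_prop) _ _ (by simp))
      · filter_upwards [self_mem_nhdsWithin] with t ht
        simpa using ht
    have h2 := ((hφ.tendsto_mul_eval (X ^ (w + 2))).comp
      (tendsto_I_mul_stripAtImInfty.comp h1)).const_mul (2 * e)
    rw [mul_zero] at h2
    refine h2.congr' ?_
    filter_upwards [self_mem_nhdsWithin] with t ht
    have ht : 0 < t := ht
    have h3 := hφ.fricke (I * ((2 * t)⁻¹ : ℝ)) (by simpa using ht)
    have ht' : (t : ℂ) ≠ 0 := by exact_mod_cast ht.ne'
    have h4 : -1 / (2 * (I * ((2 * t)⁻¹ : ℝ))) = I * t := by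
      push_cast
      field_simp
      rw [I_sq]
    rw [h4] at h3
    rw [h3]
    simp
    ring
  obtain ⟨c, hc, hdec⟩ := hφ.decay
  have htop : (fun t : ℝ => φ (I * t)) =O[atTop] fun t : ℝ => t ^ (-(j + 2 : ℝ)) := by
    have h1 := (hdec.mono (show stripAtImInfty ≤ _ from inf_le_left)).comp_tendsto
      tendsto_I_mul_stripAtImInfty
    refine h1.trans (((isLittleO_exp_neg_mul_rpow_atTop hc (-(j + 2 : ℝ))).isBigO).congr_left ?_)
    intro t
    simp
  have := mellinConvergent_of_isBigO_rpow (s := (j + 1 : ℂ)) (b := 0)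
    (hcont.locallyIntegrableOn measurableSet_Ioi) htop (by simp)
    (by simpa using hzero.isBigO_one ℝ) (by simp; positivity)
  refine IntegrableOn.congr_fun this (fun t _ => ?_) measurableSet_Ioi
  simp [mul_comm]

lemma integrableOn_eval (hφ : IsFrickeNewform w e φ) (Q : ℂ[X]) :
    IntegrableOn (fun t : ℝ => φ (I * t) * Q.eval (I * t)) (Set.Ioi 0) := by
  have : (fun t : ℝ => φ (I * t) * Q.eval (I * t))
      = fun t : ℝ => ∑ i ∈ Finset.range (Q.natDegree + 1),
          (Q.coeff i * I ^ i) * (φ (I * t) * (t : ℂ) ^ i) := by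
    ext t
    rw [eval_eq_sum_range, Finset.mul_sum]
    exact Finset.sum_congr rfl fun i _ => by ring
  rw [this]
  exact integrable_finsetSum _ fun i _ => (hφ.integrableOn_pow i).const_mul _

/-- Integration against `φ` along the imaginary axis, as a functional on polynomials. -/
def period (hφ : IsFrickeNewform w e φ) : ℂ[X] →ₗ[ℂ] ℂ where
  toFun Q := ∫ t in Set.Ioi (0 : ℝ), φ (I * t) * Q.eval (I * t)
  map_add' P Q := by
    rw [← integral_add (hφ.integrableOn_eval P) (hφ.integrableOn_eval Q)]
    simp [mul_add]
  map_smul' a Q := by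
    rw [RingHom.id_apply, smul_eq_mul, ← integral_const_mul]
    simp [mul_left_comm]

lemma period_apply (hφ : IsFrickeNewform w e φ) (Q : ℂ[X]) :
    hφ.period Q = ∫ t in Set.Ioi (0 : ℝ), φ (I * t) * Q.eval (I * t) := rfl

lemma tendsto_inv_two_mul : Tendsto (fun T : ℝ => (2 * T)⁻¹) atTop (𝓝[>] 0) :=
  tendsto_inv_atTop_nhdsGT_zero.comp (tendsto_id.const_mul_atTop two_pos)

lemma tendsto_period (hφ : IsFrickeNewform w e φ) {G : ℂ → ℂ} {Q : ℂ[X]}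
    (hG : ∀ z : ℂ, 0 < z.im → HasDerivAt G (φ z * Q.eval z) z) :
    Tendsto (fun T : ℝ => G (I * T) - G (I * ((2 * T)⁻¹ : ℝ))) atTop (𝓝 (I * hφ.period Q)) := by
  rw [period_apply, ← integral_const_mul]
  refine tendsto_sub_integral_Ioi (G := fun t : ℝ => G (I * t)) (fun t ht => ?_)
    ((hφ.integrableOn_eval Q).const_mul I) tendsto_inv_two_mul tendsto_id
  have h1 : HasDerivAt (fun t : ℝ => I * (t : ℂ)) I t := by
    simpa using (hasDerivAt_id t).ofReal_comp.const_mul I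
  have := (hG (I * t) (by simpa using ht)).comp t h1
  rw [mul_comm I (φ _ * _)]
  exact this

lemma exists_primitive (hφ : IsFrickeNewform w e φ) (Q : ℂ[X]) :
    ∃ F : ℂ → ℂ, ∀ z : ℂ, 0 < z.im → HasDerivAt F (φ z * Q.eval z) z :=
  (hφ.differentiableOn.mul Q.differentiable.differentiableOn).exists_primitive_upperHalfPlane

lemma im_fricke_pos {z : ℂ} (hz : 0 < z.im) : 0 < (-1 / (2 * z)).im := by
  have hz0 : z ≠ 0 := by rintro rfl; simp at hz
  have : (-1 / (2 * z)).im = z.im / (2 * normSq z) := by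
    have := (normSq_pos.2 hz0).ne'
    simp [div_im]
    field_simp
  rw [this]
  have := normSq_pos.2 hz0
  positivity

lemma hasDerivAt_comp_fricke (hφ : IsFrickeNewform w e φ) {F : ℂ → ℂ} {p : ℕ} (hp : p ≤ w)
    (hF : ∀ z : ℂ, 0 < z.im → HasDerivAt F (φ z * (X ^ p : ℂ[X]).eval z) z) {z : ℂ}
    (hz : 0 < z.im) :
    HasDerivAt (fun z => F (-1 / (2 * z)))
      (φ z * (C (e * (-1) ^ p / 2 ^ p) * X ^ (w - p) : ℂ[X]).eval z) z := by
  have hz0 : z ≠ 0 := by rintro rfl; simp at hz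
  have h1 : HasDerivAt (fun z : ℂ => -1 / (2 * z)) (1 / (2 * z ^ 2)) z := by
    convert! (hasDerivAt_const z (-1 : ℂ)).div ((hasDerivAt_id z).const_mul 2)
      (mul_ne_zero two_ne_zero hz0) using 1
    simp
    field_simp
  convert! (hF _ (im_fricke_pos hz)).comp z h1 using 1
  obtain ⟨q, rfl⟩ := Nat.exists_eq_add_of_le hp
  rw [hφ.fricke z hz, Nat.add_sub_cancel_left]
  simp only [eval_mul, eval_C, eval_pow, eval_X, div_pow, mul_pow]
  field_simp
  ring

lemma lower_denom_ne_zero {σ : ℝ} (hσ : σ = 1 ∨ σ = -1) {z : ℂ} (hz : 0 < z.im) :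
    2 * σ * z + 1 ≠ 0 := by
  intro h
  have := congrArg Complex.im h
  rcases hσ with rfl | rfl <;> simp at this <;> linarith

lemma im_lower_pos {σ : ℝ} (hσ : σ = 1 ∨ σ = -1) {z : ℂ} (hz : 0 < z.im) :
    0 < (z / (2 * σ * z + 1)).im := by
  have hn := normSq_pos.2 (lower_denom_ne_zero hσ hz)
  have : (z / (2 * σ * z + 1)).im = z.im / normSq (2 * σ * z + 1) := by
    rw [div_im]
    field_simp
    simp
    ring
  rw [this]
  positivity

lemma hasDerivAt_comp_lower (hφ : IsFrickeNewform w e φ) {σ : ℝ} (hσ : σ = 1 ∨ σ = -1)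
    {F : ℂ → ℂ} {p : ℕ} (hp : p ≤ w)
    (hF : ∀ z : ℂ, 0 < z.im → HasDerivAt F (φ z * (X ^ p : ℂ[X]).eval z) z) {z : ℂ}
    (hz : 0 < z.im) :
    HasDerivAt (fun z => F (z / (2 * σ * z + 1)))
      (φ z * (X ^ p * (C (2 * σ : ℂ) * X + 1) ^ (w - p) : ℂ[X]).eval z) z := by
  have hne := lower_denom_ne_zero hσ hz
  have h1 : HasDerivAt (fun z : ℂ => z / (2 * σ * z + 1)) (1 / (2 * σ * z + 1) ^ 2) z := by
    convert! (hasDerivAt_id z).div (((hasDerivAt_id z).const_mul (2 * σ : ℂ)).add_const 1)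
      hne using 1
    simp
    ring
  convert! (hF _ (im_lower_pos hσ hz)).comp z h1 using 1
  obtain ⟨q, rfl⟩ := Nat.exists_eq_add_of_le hp
  rw [hφ.lower σ hσ z hz, Nat.add_sub_cancel_left]
  simp only [eval_mul, eval_C, eval_pow, eval_X, eval_add, eval_one, div_pow]
  generalize 2 * σ * z + 1 = d at hne ⊢
  field_simp
  ring

/-- The functional equation of the moments under the Fricke involution. -/
lemma period_X_pow (hφ : IsFrickeNewform w e φ) {p : ℕ} (hp : p ≤ w) :
    hφ.period (X ^ p) = -(e * (-1) ^ p / 2 ^ p) * hφ.period (X ^ (w - p)) := by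
  obtain ⟨F, hF⟩ := hφ.exists_primitive (X ^ p)
  have h1 := hφ.tendsto_period hF
  have h2 := hφ.tendsto_period (fun z hz => hφ.hasDerivAt_comp_fricke hp hF hz)
  rw [← smul_eq_C_mul, map_smul, smul_eq_mul] at h2
  have h3 := tendsto_nhds_unique (h1.congr' ?_) h2.neg
  · refine mul_left_cancel₀ I_ne_zero (h3.trans ?_)
    ring
  · filter_upwards [eventually_gt_atTop 0] with T hT
    have hT' : (T : ℂ) ≠ 0 := by exact_mod_cast hT.ne'
    have e1 : -1 / (2 * (I * T)) = I * ((2 * T)⁻¹ : ℝ) := by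
      push_cast
      field_simp
      rw [I_sq]
    have e2 : -1 / (2 * (I * ((2 * T)⁻¹ : ℝ))) = I * T := by
      push_cast
      field_simp
      rw [I_sq]
    rw [e1, e2]
    ring

/-- Integrating a primitive along the vertical line from `σ / 2` to `i∞`. -/
lemma tendsto_half_line (hφ : IsFrickeNewform w e φ) {σ : ℝ} (hσ : σ = 1 ∨ σ = -1)
    {F : ℂ → ℂ} {Q : ℂ[X]}
    (hF : ∀ z : ℂ, 0 < z.im → HasDerivAt F (φ z * Q.eval z) z) :
    Tendsto (fun T : ℝ => F ((I * (2 * T : ℝ) + σ) / 2) - F ((I * ((2 * T)⁻¹ : ℝ) + σ) / 2)) atTop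
      (𝓝 (I * (-e * hφ.period (Q.comp (C (1 / 2) * X + C (σ / 2 : ℂ)))
        - hφ.period (Q.comp (X + C (σ / 2 : ℂ)))))) := by
  set P₁ : ℂ[X] := Q.comp (C (1 / 2) * X + C (σ / 2 : ℂ))
  set P₂ : ℂ[X] := Q.comp (X + C (σ / 2 : ℂ))
  have hi1 := (hφ.integrableOn_eval P₁).const_mul (-e * I)
  have hi2 : IntegrableOn (fun t : ℝ => I / 2 * (φ (I * (2⁻¹ * t : ℝ)) *
      P₂.eval (I * (2⁻¹ * t : ℝ)))) (Set.Ioi 0) := by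
    refine Integrable.const_mul ?_ _
    have := (integrableOn_Ioi_comp_mul_left_iff
      (fun t : ℝ => φ (I * t) * P₂.eval (I * t)) 0 (a := 2⁻¹) (by norm_num)).2
      (by simpa using hφ.integrableOn_eval P₂)
    exact this
  have hval : I * (-e * hφ.period P₁ - hφ.period P₂) = ∫ t in Set.Ioi (0 : ℝ),
      (-e * I * (φ (I * t) * P₁.eval (I * t)) -
        I / 2 * (φ (I * (2⁻¹ * t : ℝ)) * P₂.eval (I * (2⁻¹ * t : ℝ)))) := by
    rw [integral_sub hi1 hi2, integral_const_mul, integral_const_mul,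
      integral_comp_mul_left_Ioi (fun t : ℝ => φ (I * t) * P₂.eval (I * t)) 0
        (show (0 : ℝ) < 2⁻¹ by norm_num), period_apply, period_apply]
    simp
    ring
  rw [hval]
  refine tendsto_sub_integral_Ioi (G := fun t : ℝ => F ((I * t + σ) / 2)) (fun t ht => ?_)
    (hi1.sub hi2) tendsto_inv_two_mul (tendsto_id.const_mul_atTop two_pos)
  have h1 : HasDerivAt (fun t : ℝ => (I * (t : ℂ) + σ) / 2) (I / 2) t := by
    simpa using (((hasDerivAt_id t).ofReal_comp.const_mul I).add_const (σ : ℂ)).div_const 2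
  have hpos : 0 < (I * (t : ℂ)).im := by simpa using ht
  have h2 := (hF ((I * t + σ) / 2) (by simpa using ht)).comp t h1
  convert! h2 using 1
  rw [hφ.half σ hσ _ hpos]
  have e1 : P₁.eval (I * t) = Q.eval ((I * t + σ) / 2) := by
    simp only [P₁, eval_comp, eval_add, eval_mul, eval_C, eval_X]
    congr 1
    ring
  have e2 : P₂.eval (I * (2⁻¹ * t : ℝ)) = Q.eval ((I * t + σ) / 2) := by
    simp only [P₂, eval_comp, eval_add, eval_C, eval_X]
    congr 1
    push_cast
    ring
  have e3 : I * (2⁻¹ * t : ℝ) = I * t / 2 := by push_cast; ring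
  rw [Pi.sub_apply]
  rw [e1, e2, e3]
  ring

/-- The three-term relation from the ideal triangle with vertices `0`, `σ / 2`, `i∞`. -/
lemma period_triangle (hφ : IsFrickeNewform w e φ) {σ : ℝ} (hσ : σ = 1 ∨ σ = -1) {p : ℕ}
    (hp : p ≤ w) :
    hφ.period (X ^ p) + hφ.period ((X + C (σ / 2 : ℂ)) ^ p)
        + e * hφ.period ((C (1 / 2) * X + C (σ / 2 : ℂ)) ^ p)
      = hφ.period (X ^ p * (C (2 * σ : ℂ) * X + 1) ^ (w - p)) := by
  obtain ⟨F, hF⟩ := hφ.exists_primitive (X ^ p)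
  have hF1 := fun z hz => hφ.hasDerivAt_comp_fricke hp hF (z := z) hz
  have hF2 := fun z hz => hφ.hasDerivAt_comp_lower hσ hp hF (z := z) hz
  have hσ1 : |σ| = 1 := by rcases hσ with rfl | rfl <;> simp
  have hσ2 : (σ : ℂ) ^ 2 = 1 := by rcases hσ with rfl | rfl <;> simp
  have c1 := tendsto_primitive_sub_atTop hF (hφ.tendsto_mul_eval _) (x := σ / 2) (y := 0)
    (by rw [abs_div, hσ1]; norm_num) (by simp)
  have c2 := tendsto_primitive_sub_atTop hF1 (hφ.tendsto_mul_eval _) (x := -σ) (y := 0)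
    (by rw [abs_neg, hσ1]) (by simp)
  have c3 := tendsto_primitive_sub_atTop hF2 (hφ.tendsto_mul_eval _) (x := -σ / 2) (y := 0)
    (by rw [abs_div, abs_neg, hσ1]; norm_num) (by simp)
  have l1 := hφ.tendsto_period hF
  have l2 := hφ.tendsto_period hF2
  have l3 := hφ.tendsto_half_line hσ hF
  have key := tendsto_nhds_unique (((l1.sub l2).sub l3).congr' ?_) ((c1.sub c2).sub c3)
  · simp only [pow_comp, X_comp] at key
    refine mul_left_cancel₀ I_ne_zero ?_
    linear_combination key
  · filter_upwards [eventually_gt_atTop 0] with T hT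
    have hT' : (T : ℂ) ≠ 0 := by exact_mod_cast hT.ne'
    have hpos : 0 < (I * T).im := by simpa using hT
    have hpos' : 0 < (I * ((2 * T)⁻¹ : ℝ)).im := by simpa using hT
    have hpos'' : 0 < ((-σ : ℝ) + T * I : ℂ).im := by simpa using hT
    have hne'' : ((-σ : ℝ) + T * I : ℂ) ≠ 0 := by
      intro h
      rw [h] at hpos''
      simp at hpos''
    have hne := lower_denom_ne_zero hσ hpos'
    have e1 : (((0 : ℝ) : ℂ) + T * I) = I * T := by push_cast; ring
    have e2 : (I * (2 * T : ℝ) + σ) / 2 = ((σ / 2 : ℝ) + T * I : ℂ) := by push_cast; ring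
    have e3 : -1 / (2 * (I * T)) = I * ((2 * T)⁻¹ : ℝ) := by
      push_cast
      field_simp
      rw [I_sq]
    have e4 : I * ((2 * T)⁻¹ : ℝ) / (2 * σ * (I * ((2 * T)⁻¹ : ℝ)) + 1)
        = -1 / (2 * ((-σ : ℝ) + T * I)) := by
      rw [div_eq_div_iff hne (mul_ne_zero two_ne_zero hne'')]
      push_cast
      field_simp
      linear_combination (T : ℂ) * I_sq
    have e5 : ((-σ / 2 : ℝ) + T * I : ℂ) / (2 * σ * ((-σ / 2 : ℝ) + T * I) + 1)
        = (I * ((2 * T)⁻¹ : ℝ) + σ) / 2 := by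
      have hσ0 : (σ : ℂ) ≠ 0 := by
        rintro h
        simp [h] at hσ2
      have : (2 * σ * ((-σ / 2 : ℝ) + T * I) + 1 : ℂ) = 2 * σ * T * I := by
        push_cast
        linear_combination -hσ2
      rw [this]
      push_cast
      have := I_ne_zero
      field_simp
      linear_combination (-2 * T * I) * hσ2 - (σ : ℂ) * I_sq
    rw [e1, e2, e3, e4, e5]
    ring

lemma period_add_even (hφ : IsFrickeNewform w e φ) (p n : ℕ) (a b : ℂ) :
    hφ.period (X ^ p * (C a * X + C b) ^ n) + hφ.period (X ^ p * (C (-a) * X + C b) ^ n)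
      = 2 * ∑ j ∈ (Finset.range (n + 1)).filter Even,
          (n.choose j : ℂ) * (a ^ j * b ^ (n - j) * hφ.period (X ^ (p + j))) := by
  have expand (a : ℂ) : hφ.period (X ^ p * (C a * X + C b) ^ n)
      = ∑ j ∈ Finset.range (n + 1),
          (n.choose j : ℂ) * (a ^ j * b ^ (n - j) * hφ.period (X ^ (p + j))) := by
    rw [add_pow, Finset.mul_sum, map_sum]
    refine Finset.sum_congr rfl fun j _ => ?_
    have : X ^ p * ((C a * X) ^ j * C b ^ (n - j) * (n.choose j : ℂ[X]))
        = ((n.choose j : ℂ) * (a ^ j * b ^ (n - j))) • X ^ (p + j) := by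
      rw [smul_eq_C_mul]
      simp only [map_mul, map_pow, map_natCast]
      ring
    rw [this, map_smul, smul_eq_mul]
    ring
  rw [expand, expand, ← Finset.sum_add_distrib, Finset.sum_filter, Finset.mul_sum]
  refine Finset.sum_congr rfl fun j _ => ?_
  split_ifs with hj
  · rw [hj.neg_pow]
    ring
  · rw [(Nat.not_even_iff_odd.1 hj).neg_pow]
    ring

lemma two_pow_mul_period (hφ : IsFrickeNewform w e φ) {p : ℕ} (hp : p ≤ w) (hpe : Even p) :
    2 ^ p * hφ.period (X ^ p) = -e * hφ.period (X ^ (w - p)) := by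
  rw [hφ.period_X_pow hp, hpe.neg_one_pow]
  field_simp

/-- The relation between even moments obtained from the two triangles with vertices
`0`, `± 1 / 2`, `i∞`. -/
lemma even_period_relation (hφ : IsFrickeNewform w e φ) (he : e ≠ 0) {p q : ℕ} (hpq : p + q = w)
    (hp : Even p) (hq : Even q) :
    hφ.period (X ^ q) + ∑ j ∈ (Finset.range (p + 1)).filter Even,
        (p.choose j : ℂ) * hφ.period (X ^ (w - j))
      = ∑ j ∈ (Finset.range (p + 1)).filter Even, (p.choose j : ℂ) * hφ.period (X ^ j)
        + ∑ j ∈ (Finset.range (q + 1)).filter Even, (q.choose j : ℂ) * hφ.period (X ^ j) := by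
  have hpw : p ≤ w := by omega
  have hqp : w - p = q := by omega
  have t1 := hφ.period_triangle (Or.inl rfl) hpw
  have t2 := hφ.period_triangle (Or.inr rfl) hpw
  have n1 : (X + C (((-1 : ℝ) : ℂ) / 2)) ^ p = (C (-1) * X + C (1 / 2 : ℂ)) ^ p := by
    rw [← hp.neg_pow]
    congr 1
    rw [neg_add, ← C_neg]
    congr 1
    · simp
    · congr 1
      push_cast
      ring
  have n2 : (C (1 / 2) * X + C (((-1 : ℝ) : ℂ) / 2)) ^ p
      = (C (-(1 / 2)) * X + C (1 / 2 : ℂ)) ^ p := by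
    rw [← hp.neg_pow]
    congr 1
    rw [neg_add, ← C_neg]
    congr 1
    · rw [← neg_mul, ← C_neg]
    · congr 1
      push_cast
      ring
  have s1 := hφ.period_add_even 0 p 1 (1 / 2)
  have s2 := hφ.period_add_even 0 p (1 / 2) (1 / 2)
  have s3 := hφ.period_add_even p q 2 1
  rw [n1, n2, hqp] at t2
  rw [hqp] at t1
  simp only [pow_zero, one_mul, zero_add, C_1, ofReal_one, mul_one, ofReal_neg, mul_neg, one_pow]
    at s1 s2 s3 t1 t2
  have r1 : 2 ^ p * ∑ j ∈ (Finset.range (p + 1)).filter Even,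
      (p.choose j : ℂ) * ((1 / 2) ^ (p - j) * hφ.period (X ^ j))
      = -e * ∑ j ∈ (Finset.range (p + 1)).filter Even,
        (p.choose j : ℂ) * hφ.period (X ^ (w - j)) := by
    rw [Finset.mul_sum, Finset.mul_sum]
    refine Finset.sum_congr rfl fun j hj => ?_
    simp only [Finset.mem_filter, Finset.mem_range] at hj
    have h2 : (2 : ℂ) ^ p = 2 ^ (p - j) * 2 ^ j := by
      rw [← pow_add]
      congr 1
      omega
    have h3 : (2 : ℂ) ^ (p - j) * (1 / 2) ^ (p - j) = 1 := by
      rw [← mul_pow]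
      norm_num
    have h4 := hφ.two_pow_mul_period (show j ≤ w by omega) hj.2
    rw [h2]
    linear_combination (p.choose j : ℂ) * 2 ^ j * hφ.period (X ^ j) * h3 + (p.choose j : ℂ) * h4
  have r2 : 2 ^ p * ∑ j ∈ (Finset.range (p + 1)).filter Even,
      (p.choose j : ℂ) * ((1 / 2) ^ j * (1 / 2) ^ (p - j) * hφ.period (X ^ j))
      = ∑ j ∈ (Finset.range (p + 1)).filter Even, (p.choose j : ℂ) * hφ.period (X ^ j) := by
    rw [Finset.mul_sum]
    refine Finset.sum_congr rfl fun j hj => ?_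
    simp only [Finset.mem_filter, Finset.mem_range] at hj
    have h3 : (2 : ℂ) ^ p * ((1 / 2) ^ j * (1 / 2) ^ (p - j)) = 1 := by
      rw [← pow_add, Nat.add_sub_cancel' (by omega), ← mul_pow]
      norm_num
    linear_combination (p.choose j : ℂ) * hφ.period (X ^ j) * h3
  have r3 : 2 ^ p * ∑ j ∈ (Finset.range (q + 1)).filter Even,
      (q.choose j : ℂ) * (2 ^ j * hφ.period (X ^ (p + j)))
      = -e * ∑ j ∈ (Finset.range (q + 1)).filter Even, (q.choose j : ℂ) * hφ.period (X ^ j) := by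
    rw [Finset.mul_sum, Finset.mul_sum]
    refine Finset.sum_nbij' (fun j => q - j) (fun j => q - j) ?_ ?_ ?_ ?_ ?_
    · intro j hj
      simp only [Finset.mem_filter, Finset.mem_range] at hj ⊢
      exact ⟨by omega, hq.tsub hj.2⟩
    · intro j hj
      simp only [Finset.mem_filter, Finset.mem_range] at hj ⊢
      exact ⟨by omega, hq.tsub hj.2⟩
    · intro j hj
      simp only [Finset.mem_filter, Finset.mem_range] at hj
      omega
    · intro j hj
      simp only [Finset.mem_filter, Finset.mem_range] at hj
      omega
    · intro j hj
      simp only [Finset.mem_filter, Finset.mem_range] at hj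
      have h4 := hφ.two_pow_mul_period (show p + j ≤ w by omega) (hp.add hj.2)
      rw [show w - (p + j) = q - j by omega] at h4
      rw [Nat.choose_symm (show j ≤ q by omega)]
      linear_combination (q.choose j : ℂ) * h4
  have r4 := hφ.two_pow_mul_period hpw hp
  rw [hqp] at r4
  refine mul_left_cancel₀ (neg_ne_zero.2 he) ?_
  linear_combination (-1 : ℂ) * r4 - r1 - e * r2 + r3 + 2 ^ p / 2 * (t1 + t2)
    - 2 ^ p / 2 * s1 - e * 2 ^ p / 2 * s2 + 2 ^ p / 2 * s3

/-- The antisymmetrized relation between even moments, in which the Fricke eigenvalue cancels. -/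
lemma sum_choose_mul_choose_sub (hφ : IsFrickeNewform w e φ) (he : e ≠ 0) {p q : ℕ}
    (hpq : p + q = w) (hp : Even p) (hq : Even q) :
    ∑ j ∈ (Finset.range (w + 1)).filter Even,
        (w.choose j : ℂ) * ((j.choose p : ℂ) - j.choose q) * hφ.period (X ^ j)
      = w.choose p * (hφ.period (X ^ q) - hφ.period (X ^ p)) := by
  have key {p q : ℕ} (hpq : p + q = w) (hp : Even p) (hq : Even q) :
      ∑ j ∈ (Finset.range (w + 1)).filter Even,
        (w.choose j : ℂ) * (j.choose p : ℂ) * hφ.period (X ^ j)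
      = w.choose p * ∑ j ∈ (Finset.range (q + 1)).filter Even,
        (q.choose j : ℂ) * hφ.period (X ^ (w - j)) := by
    have hw : Even w := hpq ▸ hp.add hq
    rw [Finset.mul_sum]
    symm
    refine Finset.sum_of_injOn (fun j => w - j) ?_ ?_ ?_ ?_
    · intro i hi j hj hij
      simp only [Finset.coe_filter, Finset.mem_range, Set.mem_ofPred_eq] at hi hj hij
      omega
    · intro j hj
      simp only [Finset.coe_filter, Finset.mem_range, Set.mem_ofPred_eq] at hj ⊢
      exact ⟨by omega, hw.tsub hj.2⟩
    · intro j hj hj'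
      simp only [Finset.mem_filter, Finset.mem_range] at hj
      have : j < p := by
        by_contra! h
        refine hj' ⟨w - j, ?_, ?_⟩
        · simp only [Finset.coe_filter, Finset.mem_range, Set.mem_ofPred_eq]
          exact ⟨by omega, hw.tsub hj.2⟩
        · show w - (w - j) = j
          omega
      simp [Nat.choose_eq_zero_of_lt this]
    · intro j hj
      simp only [Finset.mem_filter, Finset.mem_range] at hj
      have h1 := Nat.choose_mul (n := w) (k := w - j) (s := p) (by omega)
      rw [show w - p = q by omega, show w - j - p = q - j by omega,
        Nat.choose_symm (show j ≤ q by omega)] at h1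
      have h2 : ((w.choose (w - j) : ℂ) * (w - j).choose p) = w.choose p * q.choose j := by
        exact_mod_cast h1
      rw [h2]
      ring
  have k1 := key hpq hp hq
  have k2 := key (add_comm q p ▸ hpq) hq hp
  have r1 := hφ.even_period_relation he hpq hp hq
  have r2 := hφ.even_period_relation he (add_comm q p ▸ hpq) hq hp
  have hc : (w.choose p : ℂ) = w.choose q := by
    rw [Nat.choose_symm_of_eq_add hpq.symm]
  simp only [mul_sub, sub_mul, Finset.sum_sub_distrib]
  rw [k1, k2, ← hc]
  linear_combination (w.choose p : ℂ) * (r2 - r1)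

end IsFrickeNewform


lemma fval_of_pos (f : UpperHalfPlane → ℂ) {z : ℂ} (hz : 0 < z.im) : fval f z = f ⟨z, hz⟩ :=
  dif_pos hz

lemma fval_moebius {k : ℕ} (f : CuspForm (Gamma0 2) (k : ℤ)) {a b c d : ℤ}
    (hdet : a * d - b * c = 1) (hc : (2 : ℤ) ∣ c) {z : ℂ} (hz : 0 < z.im) :
    fval f ((a * z + b) / (c * z + d)) = (c * z + d) ^ k * fval f z := by
  let γ : Matrix.SpecialLinearGroup (Fin 2) ℤ := ⟨!![a, b; c, d], by simpa using hdet⟩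
  have hγ : γ ∈ Gamma0 2 := by
    rw [Gamma0_mem]
    simpa [γ] using (ZMod.intCast_zmod_eq_zero_iff_dvd c 2).2 hc
  have h := SlashInvariantForm.slash_action_eqn_SL'' f hγ ⟨z, hz⟩
  have hcoe : ((γ • (⟨z, hz⟩ : UpperHalfPlane) : UpperHalfPlane) : ℂ)
      = (a * z + b) / (c * z + d) := by
    rw [UpperHalfPlane.specialLinearGroup_apply]
    simp [γ]
  have him : 0 < ((a * z + b) / (c * z + d)).im := by
    rw [← hcoe]
    exact (γ • (⟨z, hz⟩ : UpperHalfPlane)).im_pos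
  rw [fval_of_pos f him, fval_of_pos f hz]
  have heq : (⟨_, him⟩ : UpperHalfPlane) = γ • (⟨z, hz⟩ : UpperHalfPlane) :=
    UpperHalfPlane.ext hcoe.symm
  rw [heq, h, zpow_natCast]
  congr 2

lemma isFrickeNewform_fval {k : ℕ} (hk : 2 ≤ k) {ε : ℂ}
    (f : CuspForm (Gamma0 2) (k : ℤ))
    (hAL : ∀ z : ℂ, 0 < z.im →
      ((2 : ℂ) ^ (k / 2))⁻¹ * z ^ (-(k : ℤ)) * fval f (-1 / (2 * z)) = ε * fval f z)
    (hnew : ∀ z : ℂ, 0 < z.im →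
      (1 / 2) * (fval f (z / 2) + fval f ((z + 1) / 2))
        = -ε * 2 ^ ((k - 2) / 2) * fval f z) :
    IsFrickeNewform (k - 2) (ε * 2 ^ ((k - 2) / 2)) (fval f) where
  differentiableOn := by
    have := UpperHalfPlane.mdifferentiable_iff.1 f.holo'
    refine this.congr fun z hz => ?_
    simp [fval, UpperHalfPlane.ofComplex_apply_of_im_pos hz, show 0 < z.im from hz]
  decay := by
    obtain ⟨c, hc, h⟩ := CuspFormClass.exp_decay_atImInfty' f
    refine ⟨c, hc, ?_⟩
    obtain ⟨M, hM⟩ := h.bound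
    obtain ⟨A, hA⟩ := (UpperHalfPlane.atImInfty_mem _).1 hM
    refine IsBigO.of_bound M ?_
    filter_upwards [preimage_mem_comap (Ioi_mem_atTop (max A 0))] with z hz
    have hz : max A 0 < z.im := hz
    have hz0 : 0 < z.im := (le_max_right _ _).trans_lt hz
    rw [fval_of_pos f hz0]
    exact hA ⟨z, hz0⟩ ((le_max_left _ _).trans hz.le)
  fricke z hz := by
    have hz0 : z ≠ 0 := by
      rintro rfl
      simp at hz
    have h := hAL z hz
    rw [zpow_neg, zpow_natCast] at h
    rw [Nat.sub_add_cancel hk]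
    have h2 : (2 : ℂ) ^ (k / 2) = 2 * 2 ^ ((k - 2) / 2) := by
      rw [← pow_succ']
      congr 1
      omega
    rw [h2] at h
    rw [neg_div]
    rw [neg_div] at h
    field_simp at h
    linear_combination h
  lower σ hσ z hz := by
    rw [Nat.sub_add_cancel hk]
    rcases hσ with rfl | rfl
    · simpa using fval_moebius f (a := 1) (b := 0) (c := 2) (d := 1) (by norm_num) (by norm_num) hz
    · simpa using fval_moebius f (a := 1) (b := 0) (c := -2) (d := 1) (by norm_num) (by norm_num)
        hz
  half σ hσ z hz := by
    have h := hnew z hz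
    rcases hσ with rfl | rfl
    · push_cast
      linear_combination 2 * h
    · have him : 0 < ((z + ((-1 : ℝ) : ℂ)) / 2).im := by simpa using hz
      have ht := fval_moebius f (a := 1) (b := 1) (c := 0) (d := 1) (by norm_num) (by norm_num) him
      simp only [Int.cast_one, Int.cast_zero, zero_mul, zero_add, one_pow, one_mul, div_one] at ht
      rw [← ht, show (z + ((-1 : ℝ) : ℂ)) / 2 + 1 = (z + 1) / 2 by push_cast; ring]
      linear_combination 2 * h

lemma IsFrickeNewform.periodCoeff_eq {w k : ℕ} {e : ℂ} {f : UpperHalfPlane → ℂ}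
    (hf : IsFrickeNewform w e (fval f)) {m : ℕ} (hm : 1 ≤ m) :
    periodCoeff k f m = (k - 2).choose (m - 1) * (I * hf.period (X ^ (m - 1))) := by
  obtain ⟨j, rfl⟩ := Nat.exists_eq_add_of_le' hm
  rw [periodCoeff, hf.period_apply, mul_assoc]
  congr 1
  rw [Nat.add_sub_cancel, pow_succ', mul_assoc]
  congr 1
  rw [← integral_const_mul]
  refine integral_congr_ae (ae_of_all _ fun t => ?_)
  simp only [eval_pow, eval_X, mul_pow]
  ring

lemma ichoose_sub_one_sub_s2 {m n : ℕ} (hm : 1 ≤ m) (hn : 1 ≤ n) :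
    ichoose ((m : ℤ) - 1) ((m : ℤ) - n) = (m - 1).choose (n - 1) := by
  unfold ichoose
  split_ifs with h
  · rw [show ((m : ℤ) - 1).toNat = m - 1 by omega,
      show ((m : ℤ) - n).toNat = m - 1 - (n - 1) by omega, Nat.choose_symm (by omega)]
  · rw [Nat.choose_eq_zero_of_lt (by omega), Nat.cast_zero]

lemma eEntry_of_mem_oo {k : ℕ} {m n : ℕ × ℕ} (hm : m ∈ oo k) (hn : n ∈ oo k) :
    (eEntry m n : ℂ) = (m.1 - 1).choose (n.2 - 1) - (m.1 - 1).choose (n.1 - 1) := by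
  simp only [oo, Finset.mem_filter] at hm hn
  obtain ⟨-, hm1, -, hm3, -, -⟩ := hm
  obtain ⟨-, hn1, hn2, hn3, hn4, -⟩ := hn
  have h1 : (-1 : ℚ) ^ (n.1 : ℤ) = -1 := by rw [zpow_natCast, hn1.neg_one_pow]
  have h2 : (-1 : ℚ) ^ ((m.1 : ℤ) - (n.2 : ℤ)) = 1 :=
    Even.neg_one_zpow ((Int.odd_coe_nat _).2 hm1 |>.sub_odd ((Int.odd_coe_nat _).2 hn2))
  rw [eEntry, h1, h2, ichoose_sub_one_sub_s2 (by omega) (by omega),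
    ichoose_sub_one_sub_s2 (by omega) (by omega)]
  push_cast
  ring

lemma sum_oo_eq {k : ℕ} (hk : 2 ≤ k) (hke : Even k) (g : ℕ → ℂ) (h0 : g 0 = 0)
    (hlast : g (k - 2) = 0) :
    ∑ m ∈ oo k, g (m.1 - 1) = ∑ j ∈ (Finset.range (k - 2 + 1)).filter Even, g j := by
  refine Finset.sum_of_injOn (fun m => m.1 - 1) ?_ ?_ ?_ fun _ _ => rfl
  · intro m hm n hn hmn
    simp only [oo, Finset.coe_filter, Set.mem_ofPred_eq] at hm hn hmn
    exact Prod.ext (by omega) (by omega)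
  · intro m hm
    simp only [oo, Finset.coe_filter, Finset.mem_range, Set.mem_ofPred_eq] at hm ⊢
    exact ⟨by omega, hm.2.1.tsub_odd odd_one⟩
  · intro j hj hj'
    simp only [Finset.mem_filter, Finset.mem_range] at hj
    obtain rfl | hj0 := eq_or_ne j 0
    · exact h0
    obtain rfl | hjk := eq_or_ne j (k - 2)
    · exact hlast
    refine absurd ⟨(j + 1, k - (j + 1)), ?_, rfl⟩ hj'
    obtain ⟨r, hr⟩ := hj.2
    obtain ⟨s, hs⟩ := hke
    simp only [oo, Finset.coe_filter, Finset.mem_product, Finset.mem_range, Set.mem_ofPred_eq]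
    exact ⟨⟨by omega, by omega⟩, ⟨r, by omega⟩, ⟨s - r - 1, by omega⟩, by omega, by omega,
      by omega⟩

/-- Theorem (connection with newforms of level `Γ₀(2)`): the coefficient vector of the
restricted even period polynomial of an Atkin–Lehner eigenform `f` of weight `k` for
`Γ₀(2)` satisfying the newform relation is a left eigenvector of `D²_{k,2} ⬝ C²_{k,2}`
with eigenvalue `-(1 + ε ⬝ 2^{-(k-2)/2})`. -/
theorem stmt2 (k : ℕ) (hk : 6 ≤ k) (hke : Even k) (ε : ℂ) (hε : ε = 1 ∨ ε = -1)
    (f : CuspForm (Gamma0 2) (k : ℤ))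
    (hAL : ∀ z : ℂ, 0 < z.im →
      ((2 : ℂ) ^ (k / 2))⁻¹ * z ^ (-(k : ℤ)) * fval f (-1 / (2 * z)) = ε * fval f z)
    (hnew : ∀ z : ℂ, 0 < z.im →
      (1 / 2) * (fval f (z / 2) + fval f ((z + 1) / 2))
        = -ε * 2 ^ ((k - 2) / 2) * fval f z) :
    ∀ n ∈ oo k, ∑ m ∈ oo k, periodCoeff k f m.1 * (dc2Entry m n : ℂ)
      = -(1 + ε * ((2 : ℂ) ^ ((k - 2) / 2))⁻¹) * periodCoeff k f n.2 := by
  intro n hn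
  have hf := isFrickeNewform_fval (by omega) f hAL hnew
  obtain ⟨h1, h2, h3, h4, hsum⟩ := (Finset.mem_filter.1 hn).2
  have hp : Even (n.1 - 1) := h1.tsub_odd odd_one
  have hq : Even (n.2 - 1) := h2.tsub_odd odd_one
  have hpq : n.1 - 1 + (n.2 - 1) = k - 2 := by omega
  have hε2 : ε * ε = 1 := by rcases hε with rfl | rfl <;> norm_num
  have hε0 : ε ≠ 0 := by
    rintro rfl
    simp at hε2
  have hsym : ((k - 2).choose (n.1 - 1) : ℂ) = (k - 2).choose (n.2 - 1) := by
    rw [Nat.choose_symm_of_eq_add hpq.symm]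
  have hdelta : ∑ m ∈ oo k, periodCoeff k f m.1 *
      (((2 : ℂ) ^ (1 - (m.2 : ℤ)) - 1) * (deltaEntry m n : ℂ))
      = (((2 : ℂ) ^ (n.2 - 1))⁻¹ - 1) * periodCoeff k f n.1 := by
    rw [Finset.sum_eq_single_of_mem n hn fun m _ hm => by simp [deltaEntry, hm],
      show (1 : ℤ) - n.2 = -((n.2 - 1 : ℕ) : ℤ) by omega, zpow_neg, zpow_natCast]
    simp [deltaEntry, mul_comm]
  have hmain : ∑ m ∈ oo k, periodCoeff k f m.1 * (eEntry m n : ℂ)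
      = -I * ((k - 2).choose (n.1 - 1) *
        (hf.period (X ^ (n.2 - 1)) - hf.period (X ^ (n.1 - 1)))) := by
    rw [← hf.sum_choose_mul_choose_sub (by simp [hε0]) hpq hp hq, Finset.mul_sum,
      ← sum_oo_eq (by omega) hke]
    · refine Finset.sum_congr rfl fun m hm => ?_
      rw [eEntry_of_mem_oo hm hn, hf.periodCoeff_eq]
      · ring
      · have := (Finset.mem_filter.1 hm).2.2.2.1
        omega
    · simp [Nat.choose_eq_zero_of_lt (show 0 < n.1 - 1 by omega),
        Nat.choose_eq_zero_of_lt (show 0 < n.2 - 1 by omega)]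
    · simp [hsym]
  have hsplit : ∀ m ∈ oo k, periodCoeff k f m.1 * (dc2Entry m n : ℂ)
      = periodCoeff k f m.1 * (((2 : ℂ) ^ (1 - (m.2 : ℤ)) - 1) * (deltaEntry m n : ℂ))
        + periodCoeff k f m.1 * (eEntry m n : ℂ) := fun m _ => by
    rw [dc2Entry]
    push_cast
    ring
  rw [Finset.sum_congr rfl hsplit, Finset.sum_add_distrib, hdelta, hmain,
    hf.periodCoeff_eq (by omega), hf.periodCoeff_eq (by omega), ← hsym]
  have hfr := hf.two_pow_mul_period (p := n.1 - 1) (by omega) hp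
  rw [show k - 2 - (n.1 - 1) = n.2 - 1 by omega] at hfr
  have hpow : (2 : ℂ) ^ ((k - 2) / 2) * 2 ^ ((k - 2) / 2) = 2 ^ (n.1 - 1) * 2 ^ (n.2 - 1) := by
    rw [← pow_add, ← pow_add, hpq]
    congr 1
    obtain ⟨s, hs⟩ := hke
    omega
  have hd : ((2 : ℂ) ^ (n.2 - 1))⁻¹ * hf.period (X ^ (n.1 - 1))
      = -(ε * ((2 : ℂ) ^ ((k - 2) / 2))⁻¹) * hf.period (X ^ (n.2 - 1)) := by
    have ha : (2 : ℂ) ^ (n.1 - 1) ≠ 0 := by simp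
    field_simp
    refine mul_left_cancel₀ ha ?_
    linear_combination (2 : ℂ) ^ ((k - 2) / 2) * hfr
      - ε * hf.period (X ^ (n.2 - 1)) * hpow
  linear_combination ((k - 2).choose (n.1 - 1) : ℂ) * I * hd
end
end
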